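/- arXiv:1601.01234 — 9 statements merged into one kernel-verified Lean document; each statement's English description precedes it below -/
import Mathlib

section
/- Let σ, σ' ∈ (0,1), c ∈ ℝ and K₀ ∈ (0,∞). Define the kernels k₁(s) = e^{-c s} s^{-σ'} for s > 0 (and k₁(s) = 0 for s ≤ 0) and k₂(s) = K₀ e^{-c s} s^{-σ} for s > 0 (and k₂(s) = 0 for s ≤ 0), and define, for s > 0, k̄₁(s) = e^{-c s} s^{-σ'} · Σ_{n=0}^∞ (K₀ Γ(1−σ))ⁿ Γ(1−σ') / Γ(n(1−σ) + (1−σ')) · s^{n(1−σ)} and k̄₂(s) = e^{-c s} s^{-σ} · Σ_{n=0}^∞ (K₀ Γ(1−σ))^{n+1} / Γ((n+1)(1−σ)) · s^{n(1−σ)}. Suppose f, g, h : [0,∞) → [0,∞) are locally bounded measurable functions such that for every t ≥ 0, f(t) ≤ g(t) + ∫₀ᵗ k₁(t−s) h(s) ds + ∫₀ᵗ k₂(t−s) f(s) ds. Then for every t ≥ 0, f(t) ≤ g(t) + ∫₀ᵗ ( k̄₂(t−s) g(s) + k̄₁(t−s) h(s) ) ds. -/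
open MeasureTheory Real Filter

noncomputable def gwP (c a : ℝ) (u : ℝ) : ENNReal :=
  ENNReal.ofReal (if 0 < u then Real.exp (-(c*u)) * (u ^ (a-1) / Real.Gamma a) else 0)

lemma gwP_meas (c a : ℝ) : Measurable (gwP c a) := by
  unfold gwP
  exact ENNReal.measurable_ofReal.comp
    (Measurable.ite measurableSet_Ioi (by fun_prop) measurable_const)

lemma gwP_nonpos (c a : ℝ) {u : ℝ} (hu : u ≤ 0) : gwP c a u = 0 := by
  simp [gwP, not_lt.2 hu]

lemma gwP_pos (c a : ℝ) {u : ℝ} (hu : 0 < u) :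
    gwP c a u = ENNReal.ofReal (Real.exp (-(c*u)) * (u ^ (a-1) / Real.Gamma a)) := by
  simp [gwP, hu]

lemma gwP_conv (c : ℝ) {a b : ℝ} (ha : 0 < a) (hb : 0 < b) :
    gwP c a ⋆ₗ gwP c b = gwP c (a+b) := by
  ext t
  rw [lconvolution_def]
  rcases le_or_gt t 0 with ht | ht
  · rw [gwP_nonpos c (a+b) ht, lintegral_eq_zero_iff' (by
      have := gwP_meas c a
      have := gwP_meas c b
      fun_prop)]
    refine Eventually.of_forall fun y => ?_
    rcases le_or_gt y 0 with hy | hy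
    · simp [gwP_nonpos c a hy]
    · simp [gwP_nonpos c b (show -y + t ≤ 0 by linarith)]
  · have key : ∀ y, gwP c a y * gwP c b (-y+t) =
        (gwP c (a+b) t * ENNReal.ofReal t⁻¹) * ProbabilityTheory.betaPDF a b (t⁻¹ * y) := by
      intro y
      rcases le_or_gt y 0 with hy | hy
      · rw [gwP_nonpos c a hy, ProbabilityTheory.betaPDF_eq_zero_of_nonpos
          (mul_nonpos_of_nonneg_of_nonpos (by positivity) hy)]
        simp
      rcases le_or_gt t y with hy' | hy'
      · rw [gwP_nonpos c b (by linarith), ProbabilityTheory.betaPDF_eq_zero_of_one_le]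
        · simp
        · rw [inv_mul_eq_div, le_div_iff₀ ht]; linarith
      have hty : 0 < t - y := by linarith
      have e1 : 1 - t⁻¹ * y = t⁻¹ * (t - y) := by field_simp
      have hGa := Real.Gamma_pos_of_pos ha
      have hGb := Real.Gamma_pos_of_pos hb
      have hGab := Real.Gamma_pos_of_pos (add_pos ha hb)
      rw [gwP_pos c a hy, gwP_pos c b (by linarith), gwP_pos c _ ht,
        ProbabilityTheory.betaPDF_of_pos_lt_one (by positivity)
          (by rw [inv_mul_eq_div, div_lt_one ht]; exact hy'), e1, 
        ← ENNReal.ofReal_mul (by positivity), ← ENNReal.ofReal_mul (by positivity),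
        ← ENNReal.ofReal_mul (by positivity)]
      congr 1
      rw [Real.mul_rpow (by positivity) hy.le, Real.mul_rpow (by positivity) hty.le,
        ProbabilityTheory.beta, show -y + t = t - y by ring,
        show -(c*t) = -(c*y) + -(c*(t-y)) by ring, Real.exp_add]
      have e2 : t ^ (a+b-1) * t⁻¹ * (t⁻¹ ^ (a-1) * t⁻¹ ^ (b-1)) = 1 := by
        rw [Real.inv_rpow ht.le, Real.inv_rpow ht.le, ← Real.rpow_neg ht.le,
          ← Real.rpow_neg ht.le, ← Real.rpow_neg_one t, ← Real.rpow_add ht, ← Real.rpow_add ht,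
          ← Real.rpow_add ht]
        convert Real.rpow_zero t using 2
        ring
      calc _ = (t ^ (a+b-1) * t⁻¹ * (t⁻¹ ^ (a-1) * t⁻¹ ^ (b-1))) * _ := by rw [e2, one_mul]
        _ = _ := by field_simp
    simp_rw [key]
    have hm : Measurable (ProbabilityTheory.betaPDF a b) := by
      unfold ProbabilityTheory.betaPDF; fun_prop
    rw [lintegral_const_mul _ (by fun_prop)]
    have h2 : ∫⁻ y, ProbabilityTheory.betaPDF a b (t⁻¹ * y) = ENNReal.ofReal t := by
      rw [← lintegral_map (f := ProbabilityTheory.betaPDF a b) (g := fun y => t⁻¹ * y) hm (by fun_prop)]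
      rw [Real.map_volume_mul_left (by positivity), lintegral_smul_measure,
        ProbabilityTheory.lintegral_betaPDF_eq_one ha hb]
      simp [abs_of_pos ht]
    rw [h2, mul_assoc, ← ENNReal.ofReal_mul (by positivity), inv_mul_cancel₀ ht.ne']
    simp

lemma gw_Gamma_lower {y R : ℝ} (hy : 1 ≤ y) (hR : 0 < R) :
    R ^ (y-1) * Real.exp (-R) ≤ Real.Gamma y := by
  have hint := Real.GammaIntegral_convergent (s := y) (by linarith)
  rw [Real.Gamma_eq_integral (by linarith)]
  calc R ^ (y-1) * Real.exp (-R) = ∫ x in Set.Ioi R, Real.exp (-x) * R ^ (y-1) := by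
        rw [integral_mul_const, integral_exp_neg_Ioi, mul_comm]
    _ ≤ ∫ x in Set.Ioi R, Real.exp (-x) * x ^ (y-1) := by
        refine setIntegral_mono_on ?_ (hint.mono_set (Set.Ioi_subset_Ioi hR.le)) measurableSet_Ioi ?_
        · exact (integrableOn_exp_neg_Ioi R).mul_const _
        · intro x hx
          have : R < x := hx
          gcongr
    _ ≤ _ := by
        refine setIntegral_mono_set hint ?_ (Set.Ioi_subset_Ioi hR.le).eventuallyLE
        refine (ae_restrict_iff' measurableSet_Ioi).2 (Eventually.of_forall fun x hx => ?_)
        have : 0 < x := hx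
        simp only [Pi.zero_apply]
        positivity

lemma gw_summable {α b x : ℝ} (hα : 0 < α) (hx : 0 < x) :
    Summable fun n : ℕ => x ^ n / Real.Gamma (n*α+b) := by
  set R : ℝ := (2*x) ^ (α⁻¹) with hRdef
  have hR : 0 < R := by positivity
  have hRα : R ^ α = 2*x := by
    rw [hRdef, ← Real.rpow_mul (by positivity), inv_mul_cancel₀ hα.ne', Real.rpow_one]
  have hgeo : Summable fun n : ℕ => (R ^ (b-1) * Real.exp (-R))⁻¹ * (1/2:ℝ)^n :=
    (summable_geometric_of_lt_one (by norm_num) (by norm_num)).mul_left _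
  refine hgeo.of_norm_bounded_eventually_nat ?_
  have hl : Tendsto (fun n : ℕ => (n:ℝ)*α+b) atTop atTop :=
    tendsto_atTop_add_const_right _ _ (tendsto_natCast_atTop_atTop.atTop_mul_const hα)
  filter_upwards [hl.eventually_ge_atTop 1] with n hn
  have h1 := gw_Gamma_lower hn hR
  have h2 : R ^ ((n:ℝ)*α+b-1) = (2*x)^n * R ^ (b-1) := by
    rw [show (n:ℝ)*α+b-1 = α * n + (b-1) by ring, Real.rpow_add hR, Real.rpow_mul hR.le, hRα,
      Real.rpow_natCast]
  rw [h2] at h1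
  have h3 : 0 < (2*x)^n * R ^ (b-1) * Real.exp (-R) := by positivity
  rw [Real.norm_of_nonneg (div_nonneg (by positivity) (h3.le.trans h1))]
  calc _ ≤ x ^ n / ((2*x)^n * R ^ (b-1) * Real.exp (-R)) := by gcongr
    _ = _ := by
      rw [mul_pow, one_div, inv_pow]; field_simp

lemma gwP_tsum_lt_top (c : ℝ) {α b κ : ℝ} (hα : 0 < α) (hb : 0 < b) (hκ : 0 < κ) (t : ℝ) :
    ∑' n : ℕ, ENNReal.ofReal κ ^ n * gwP c (n*α+b) t ≠ ⊤ := by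
  rcases le_or_gt t 0 with ht | ht
  · simp [gwP_nonpos c _ ht]
  have hs := (gw_summable (b := b) hα (show 0 < κ * t ^ α by positivity)).mul_left
    (Real.exp (-(c*t)) * t ^ (b-1))
  convert hs.tsum_ofReal_ne_top using 4 with n
  have := Real.Gamma_pos_of_pos (show 0 < n*α+b by positivity)
  rw [gwP_pos c _ ht, ← ENNReal.ofReal_pow hκ.le, ← ENNReal.ofReal_mul (by positivity)]
  congr 1
  rw [show (n:ℝ)*α+b-1 = α * n + (b-1) by ring, Real.rpow_add ht, Real.rpow_mul ht.le,
      Real.rpow_natCast, mul_pow]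
  ring

lemma gw_const_conv (k : ENNReal) {X Y : ℝ → ENNReal} (hX : Measurable X) (hY : Measurable Y) :
    X ⋆ₗ (fun u => k * Y u) = fun u => k * (X ⋆ₗ Y) u := by
  ext t
  simp only [lconvolution_def]
  rw [← lintegral_const_mul _ (by fun_prop)]
  congr 1; ext y; ring

lemma gw_const_conv_left (k : ENNReal) {X Y : ℝ → ENNReal} (hX : Measurable X) (hY : Measurable Y) :
    (fun u => k * X u) ⋆ₗ Y = fun u => k * (X ⋆ₗ Y) u := by
  ext t
  simp only [lconvolution_def]
  rw [← lintegral_const_mul _ (by fun_prop)]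
  congr 1; ext y; ring

lemma gw_tsum_conv {X : ℝ → ENNReal} {Y : ℕ → ℝ → ENNReal} (hX : Measurable X)
    (hY : ∀ n, Measurable (Y n)) (t : ℝ) :
    (X ⋆ₗ (fun u => ∑' n, Y n u)) t = ∑' n, (X ⋆ₗ Y n) t := by
  simp only [lconvolution_def, ← ENNReal.tsum_mul_left]
  exact lintegral_tsum fun n => by have := hY n; fun_prop

lemma gw_add_conv {X X' Y : ℝ → ENNReal} (hX : Measurable X) (hY : Measurable Y) (t : ℝ) :
    ((fun u => X u + X' u) ⋆ₗ Y) t = (X ⋆ₗ Y) t + (X' ⋆ₗ Y) t := by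
  simp only [lconvolution_def, add_mul]
  exact lintegral_add_left (by fun_prop) _

lemma gw_mono {X X' : ℝ → ENNReal} (Y : ℝ → ENNReal) (h : ∀ u, X u ≤ X' u) (t : ℝ) :
    (X ⋆ₗ Y) t ≤ (X' ⋆ₗ Y) t := by
  simp only [lconvolution_def]
  exact lintegral_mono fun y => by dsimp only; gcongr; exact h y

/-- bound for locally bounded functions -/
lemma gw_bound (c : ℝ) {a : ℝ} (ha : 0 < a) {X : ℝ → ENNReal} (hX0 : ∀ y < 0, X y = 0)
    {t : ℝ} {M : ENNReal} (hM : ∀ y, 0 < y → y ≤ t → X y ≤ M * gwP c 1 y) :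
    (X ⋆ₗ gwP c a) t ≤ M * gwP c (1+a) t := by
  have h1 := gwP_meas c 1
  have h2 := gwP_meas c a
  rw [← gwP_conv c one_pos ha]
  simp only [lconvolution_def]
  rw [← lintegral_const_mul _ (by fun_prop)]
  refine lintegral_mono_ae ?_
  filter_upwards [compl_mem_ae_iff.2 (measure_singleton (0:ℝ))] with y hy
  rw [← mul_assoc]
  rcases lt_trichotomy y 0 with h | h | h
  · simp [hX0 y h]
  · exact absurd h hy
  rcases le_or_gt y t with h' | h'
  · gcongr; exact hM y h h'
  · simp [gwP_nonpos c a (show -y + t ≤ 0 by linarith)]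

/-- abstract Gronwall -/
lemma gw_abstract (c : ℝ) {α β κ : ℝ} (hα : 0 < α) (hβ : 0 < β) (hκ : 0 < κ) (d : ENNReal)
    {F G H : ℝ → ENNReal} (hF : Measurable F) (hG : Measurable G) (hH : Measurable H)
    (hF0 : ∀ y < 0, F y = 0)
    (hFb : ∀ t, ∃ M : ENNReal, M ≠ ⊤ ∧ ∀ y, 0 < y → y ≤ t → F y ≤ M * gwP c 1 y)
    (hm : ∀ t, F t ≤ G t + d * (H ⋆ₗ gwP c β) t + ENNReal.ofReal κ * (F ⋆ₗ gwP c α) t) (t : ℝ) :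
    F t ≤ G t + ((G ⋆ₗ fun u => ∑' n : ℕ, ENNReal.ofReal κ ^ (n+1) * gwP c ((n+1)*α) u) t
      + (H ⋆ₗ fun u => ∑' n : ℕ, d * (ENNReal.ofReal κ ^ n * gwP c (n*α+β) u)) t) := by
  have hP := gwP_meas c
  set k := ENNReal.ofReal κ
  have hpos : ∀ n : ℕ, 0 < ((n:ℝ)+1)*α := fun n => by positivity
  -- one iteration
  have step : ∀ n : ℕ, k^(n+1) * (F ⋆ₗ gwP c ((n+1)*α)) t ≤
      k^(n+1) * (G ⋆ₗ gwP c ((n+1)*α)) t + d * (k^(n+1) * (H ⋆ₗ gwP c (((n+1:ℕ):ℝ)*α+β)) t)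
      + k^(n+1+1) * (F ⋆ₗ gwP c (((n+1:ℕ)+1)*α)) t := by
    intro n
    have hc1 := measurable_lconvolution volume hH (hP β)
    have hc2 := measurable_lconvolution volume hF (hP α)
    have h1 := gw_mono (gwP c ((n+1)*α)) hm t
    rw [gw_add_conv (by fun_prop) (hP _), gw_add_conv hG (hP _), gw_const_conv_left _ hc1 (hP _),
      gw_const_conv_left _ hc2 (hP _), ← lconvolution_assoc hH (hP _) (hP _),
      ← lconvolution_assoc hF (hP _) (hP _), gwP_conv c hβ (hpos n), gwP_conv c hα (hpos n)] at h1
    have e1 : β + ((n:ℝ)+1)*α = ((n+1:ℕ):ℝ)*α+β := by push_cast; ring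
    have e2 : α + ((n:ℝ)+1)*α = ((n+1:ℕ)+1:ℝ)*α := by push_cast; ring
    rw [e1, e2] at h1
    calc _ ≤ _ := mul_le_mul_right h1 (k^(n+1))
      _ = _ := by ring
  have iter : ∀ n : ℕ, F t ≤ G t + (∑ j ∈ Finset.range n, k^(j+1) * (G ⋆ₗ gwP c ((j+1)*α)) t
      + ∑ j ∈ Finset.range (n+1), d * (k^j * (H ⋆ₗ gwP c (j*α+β)) t))
      + k^(n+1) * (F ⋆ₗ gwP c ((n+1)*α)) t := by
    intro n
    induction n with
    | zero => simpa using hm t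
    | succ n ih =>
      refine (ih.trans (add_le_add_right (step n) _)).trans (le_of_eq ?_)
      rw [Finset.sum_range_succ (fun j : ℕ => k^(j+1) * (G ⋆ₗ gwP c ((j+1)*α)) t) n,
        Finset.sum_range_succ _ (n+1)]
      ring
  have hlim : Tendsto (fun n : ℕ => k^(n+1) * (F ⋆ₗ gwP c ((n+1)*α)) t) atTop (nhds 0) := by
    obtain ⟨M, hMt, hM⟩ := hFb t
    have h1 := ENNReal.tendsto_atTop_zero_of_tsum_ne_top
      (gwP_tsum_lt_top c hα one_pos hκ t)
    have h2 := ENNReal.Tendsto.const_mul (a := M) ((tendsto_add_atTop_iff_nat 1).2 h1) (Or.inr hMt)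
    rw [mul_zero] at h2
    refine tendsto_of_tendsto_of_tendsto_of_le_of_le tendsto_const_nhds h2 (fun _ => zero_le) ?_
    intro n
    calc k^(n+1) * (F ⋆ₗ gwP c ((n+1)*α)) t
        ≤ k^(n+1) * (M * gwP c (1+(n+1)*α) t) := by
          gcongr; exact gw_bound c (hpos n) hF0 hM
      _ = _ := by
        rw [add_comm (1:ℝ)]; push_cast; ring
  rw [gw_tsum_conv hG (fun n => by have := hP ((n+1)*α); fun_prop),
    gw_tsum_conv hH (fun n => by have := hP (n*α+β); fun_prop)]
  have e1 : ∀ n : ℕ, (G ⋆ₗ fun u => k ^ (n+1) * gwP c ((n+1)*α) u) t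
      = k^(n+1) * (G ⋆ₗ gwP c ((n+1)*α)) t := fun n => by rw [gw_const_conv _ hG (hP _)]
  have e2 : ∀ n : ℕ, (H ⋆ₗ fun u => d * (k ^ n * gwP c (n*α+β) u)) t
      = d * (k^n * (H ⋆ₗ gwP c (n*α+β)) t) := fun n => by
    have := hP (n*α+β)
    rw [gw_const_conv _ hH (by fun_prop), gw_const_conv _ hH (hP _)]
  simp_rw [e1, e2]
  have hlim2 := hlim.const_add (G t + (∑' n : ℕ, k^(n+1) * (G ⋆ₗ gwP c ((n+1)*α)) t
      + ∑' n : ℕ, d * (k^n * (H ⋆ₗ gwP c (n*α+β)) t)))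
  rw [add_zero] at hlim2
  refine ge_of_tendsto' hlim2 fun n => (iter n).trans ?_
  gcongr
  · exact ENNReal.sum_le_tsum _
  · exact ENNReal.sum_le_tsum (f := fun n : ℕ => d * (k^n * (H ⋆ₗ gwP c (n*α+β)) t)) _

lemma gw_toE_meas {f : ℝ → ℝ} (hf : Measurable f) :
    Measurable ((Set.Ici (0:ℝ)).indicator fun y => ENNReal.ofReal (f y)) :=
  (ENNReal.measurable_ofReal.comp hf).indicator measurableSet_Ici

lemma gw_locbd (c : ℝ) {f : ℝ → ℝ}
    (hfloc : ∀ T : ℝ, 0 ≤ T → ∃ M : ℝ, ∀ t ∈ Set.Icc (0:ℝ) T, f t ≤ M) (t : ℝ) :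
    ∃ M : ENNReal, M ≠ ⊤ ∧ ∀ y, 0 < y → y ≤ t →
      (Set.Ici (0:ℝ)).indicator (fun y => ENNReal.ofReal (f y)) y ≤ M * gwP c 1 y := by
  rcases lt_or_ge t 0 with ht | ht
  · exact ⟨0, by simp, fun y h1 h2 => absurd (h1.trans_le h2) (not_lt.2 ht.le)⟩
  obtain ⟨M, hM⟩ := hfloc t ht
  refine ⟨ENNReal.ofReal (|M| * Real.exp (|c| * t)), ENNReal.ofReal_ne_top, fun y h1 h2 => ?_⟩
  rw [Set.indicator_of_mem (Set.mem_Ici.2 h1.le), gwP_pos c 1 h1,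
    ← ENNReal.ofReal_mul (by positivity)]
  apply ENNReal.ofReal_le_ofReal
  have h3 : f y ≤ |M| := (hM y ⟨h1.le, h2⟩).trans (le_abs_self M)
  have h4 : 1 ≤ Real.exp (|c| * t) * Real.exp (-(c*y)) := by
    rw [← Real.exp_add]
    apply Real.one_le_exp
    have : c * y ≤ |c| * t := by
      calc c * y ≤ |c| * y := by gcongr; exact le_abs_self c
        _ ≤ _ := by gcongr
    linarith
  simp only [sub_self, Real.rpow_zero, Real.Gamma_one, div_one, mul_one]
  nlinarith [abs_nonneg M]

/-- restricting the convolution to the interval -/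
lemma gw_restrict {x : ℝ → ENNReal} {k : ℝ → ENNReal} (hk : ∀ u ≤ 0, k u = 0) (t : ℝ) :
    ((Set.Ici (0:ℝ)).indicator x ⋆ₗ k) t = ∫⁻ y in Set.Ioo 0 t, x y * k (-y+t) := by
  rw [lconvolution_def, setLIntegral_congr Ioo_ae_eq_Ico, ← lintegral_indicator measurableSet_Ico]
  congr 1
  ext y
  by_cases h0 : 0 ≤ y
  · by_cases h1 : y < t
    · rw [Set.indicator_of_mem (Set.mem_Ici.2 h0), Set.indicator_of_mem (Set.mem_Ico.2 ⟨h0, h1⟩)]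
    · rw [hk _ (by linarith), Set.indicator_of_notMem (s := Set.Ico 0 t) (fun h => h1 h.2)]
      simp
  · rw [Set.indicator_of_notMem (by simpa using h0), Set.indicator_of_notMem (fun h => h0 h.1)]
    simp

lemma gw_hyp_conv {x k : ℝ → ℝ} {kE : ℝ → ENNReal} (hk0 : ∀ u ≤ 0, kE u = 0)
    (hk : ∀ u, 0 < u → 0 ≤ k u ∧ kE u = ENNReal.ofReal (k u)) (hx : ∀ y, 0 ≤ y → 0 ≤ x y)
    {t : ℝ} (ht : 0 ≤ t) :
    ENNReal.ofReal (∫ u in (0:ℝ)..t, k (t-u) * x u) ≤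
      ((Set.Ici (0:ℝ)).indicator (fun y => ENNReal.ofReal (x y)) ⋆ₗ kE) t := by
  rw [gw_restrict hk0, intervalIntegral.integral_of_le ht, integral_Ioc_eq_integral_Ioo]
  refine (Real.ofReal_le_enorm _).trans ((enorm_integral_le_lintegral_enorm _).trans (le_of_eq ?_))
  refine setLIntegral_congr_fun measurableSet_Ioo fun y hy => ?_
  have h1 := hk (-y+t) (by linarith [hy.2])
  have h2 := hx y hy.1.le
  rw [h1.2, show t - y = -y+t by ring, Real.enorm_of_nonneg (mul_nonneg h1.1 h2),
    ENNReal.ofReal_mul h1.1, mul_comm]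

lemma gw_fin_conv (c : ℝ) {α b κ : ℝ} (hα : 0 < α) (hb : 0 < b) (hκ : 0 < κ) {d : ENNReal}
    (hd : d ≠ ⊤) {X : ℝ → ENNReal} (hX : Measurable X) (hX0 : ∀ y < 0, X y = 0)
    (hXb : ∀ t, ∃ M : ENNReal, M ≠ ⊤ ∧ ∀ y, 0 < y → y ≤ t → X y ≤ M * gwP c 1 y) (t : ℝ) :
    (X ⋆ₗ fun u => ∑' n : ℕ, d * (ENNReal.ofReal κ ^ n * gwP c (n*α+b) u)) t ≠ ⊤ := by
  have hP := gwP_meas c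
  obtain ⟨M, hMt, hM⟩ := hXb t
  rw [gw_tsum_conv hX (fun n => by have := hP (n*α+b); fun_prop)]
  have h1 : ∑' n : ℕ, (d * M) * (ENNReal.ofReal κ ^ n * gwP c (n*α+(b+1)) t) ≠ ⊤ := by
    rw [ENNReal.tsum_mul_left]
    exact ENNReal.mul_ne_top (ENNReal.mul_ne_top hd hMt)
      (gwP_tsum_lt_top c hα (by positivity) hκ t)
  refine ne_top_of_le_ne_top h1 (ENNReal.tsum_le_tsum fun n => ?_)
  have := hP (n*α+b)
  rw [gw_const_conv _ hX (by fun_prop), gw_const_conv _ hX (hP _)]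
  have h2 := gw_bound c (show 0 < n*α+b by positivity) hX0 hM
  rw [show 1 + (n*α+b) = n*α+(b+1) by ring] at h2
  calc d * (ENNReal.ofReal κ ^ n * (X ⋆ₗ gwP c (n*α+b)) t)
      _ ≤ d * (ENNReal.ofReal κ ^ n * (M * gwP c (n*α+(b+1)) t)) := by gcongr
      _ = _ := by ring

/-- the series kernel -/
lemma gw_series (c : ℝ) {α b κ d : ℝ} (hα : 0 < α) (hb : 0 < b) (hκ : 0 < κ) (hd : 0 ≤ d)
    {u : ℝ} (hu : 0 < u) :
    0 ≤ Real.exp (-(c*u)) * u ^ (b-1) *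
      ∑' n : ℕ, κ^n * d / Real.Gamma ((n:ℝ)*α + b) * u ^ ((n:ℝ)*α) ∧
    ∑' n : ℕ, ENNReal.ofReal d * (ENNReal.ofReal κ ^ n * gwP c (n*α+b) u) =
    ENNReal.ofReal (Real.exp (-(c*u)) * u ^ (b-1) *
      ∑' n : ℕ, κ^n * d / Real.Gamma ((n:ℝ)*α + b) * u ^ ((n:ℝ)*α)) := by
  have hG : ∀ n : ℕ, 0 < Real.Gamma ((n:ℝ)*α + b) := fun n =>
    Real.Gamma_pos_of_pos (by positivity)
  have hnn : ∀ n : ℕ, 0 ≤ κ^n * d / Real.Gamma ((n:ℝ)*α + b) * u ^ ((n:ℝ)*α) := fun n => by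
    have := hG n
    positivity
  have hs : Summable fun n : ℕ => κ^n * d / Real.Gamma ((n:ℝ)*α + b) * u ^ ((n:ℝ)*α) := by
    refine ((gw_summable (b := b) hα (show 0 < κ * u ^ α by positivity)).mul_left d).congr ?_
    intro n
    rw [mul_comm (n:ℝ) α, Real.rpow_mul hu.le, Real.rpow_natCast, mul_pow]
    ring
  refine ⟨mul_nonneg (by positivity) (tsum_nonneg hnn), ?_⟩
  rw [ENNReal.ofReal_mul (by positivity), ENNReal.ofReal_tsum_of_nonneg hnn hs,
    ← ENNReal.tsum_mul_left]
  congr 1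
  ext n
  have := hG n
  rw [gwP_pos c _ hu, ← ENNReal.ofReal_pow hκ.le, ← ENNReal.ofReal_mul (by positivity),
    ← ENNReal.ofReal_mul hd, ← ENNReal.ofReal_mul (by positivity)]
  congr 1
  rw [show (n:ℝ)*α+b-1 = n*α + (b-1) by ring, Real.rpow_add hu]
  ring

/-- Gronwall-type lemma with weakly singular exponentially weighted kernels
(Lemma 3.2 of the paper). -/
theorem gronwall_type_lemma
    (σ σ' c K₀ : ℝ) (hσ : σ ∈ Set.Ioo (0:ℝ) 1) (hσ' : σ' ∈ Set.Ioo (0:ℝ) 1) (hK₀ : 0 < K₀)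
    (k₁ k₂ kb₁ kb₂ : ℝ → ℝ)
    (hk₁ : ∀ u : ℝ, k₁ u = if 0 < u then Real.exp (-(c*u)) * u ^ (-σ') else 0)
    (hk₂ : ∀ u : ℝ, k₂ u = if 0 < u then K₀ * (Real.exp (-(c*u)) * u ^ (-σ)) else 0)
    (hkb₁ : ∀ u : ℝ, 0 < u → kb₁ u = Real.exp (-(c*u)) * u ^ (-σ') *
      ∑' n : ℕ, (K₀ * Real.Gamma (1-σ))^n * Real.Gamma (1-σ') /
        Real.Gamma ((n:ℝ)*(1-σ) + (1-σ')) * u ^ ((n:ℝ)*(1-σ)))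
    (hkb₂ : ∀ u : ℝ, 0 < u → kb₂ u = Real.exp (-(c*u)) * u ^ (-σ) *
      ∑' n : ℕ, (K₀ * Real.Gamma (1-σ))^(n+1) /
        Real.Gamma (((n:ℝ)+1)*(1-σ)) * u ^ ((n:ℝ)*(1-σ)))
    (f g h : ℝ → ℝ)
    (hfm : Measurable f) (hgm : Measurable g) (hhm : Measurable h)
    (hf0 : ∀ t, 0 ≤ t → 0 ≤ f t) (hg0 : ∀ t, 0 ≤ t → 0 ≤ g t) (hh0 : ∀ t, 0 ≤ t → 0 ≤ h t)
    (hfloc : ∀ T : ℝ, 0 ≤ T → ∃ M : ℝ, ∀ t ∈ Set.Icc (0:ℝ) T, f t ≤ M)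
    (hgloc : ∀ T : ℝ, 0 ≤ T → ∃ M : ℝ, ∀ t ∈ Set.Icc (0:ℝ) T, g t ≤ M)
    (hhloc : ∀ T : ℝ, 0 ≤ T → ∃ M : ℝ, ∀ t ∈ Set.Icc (0:ℝ) T, h t ≤ M)
    (hmain : ∀ t, 0 ≤ t → f t ≤ g t + (∫ u in (0:ℝ)..t, k₁ (t-u) * h u)
      + (∫ u in (0:ℝ)..t, k₂ (t-u) * f u)) :
    ∀ t, 0 ≤ t → f t ≤ g t + ∫ u in (0:ℝ)..t, (kb₂ (t-u) * g u + kb₁ (t-u) * h u) := by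
  have hα : 0 < 1-σ := by linarith [hσ.2]
  have hβ : 0 < 1-σ' := by linarith [hσ'.2]
  have hGα := Real.Gamma_pos_of_pos hα
  have hGβ := Real.Gamma_pos_of_pos hβ
  have hκ : 0 < K₀ * Real.Gamma (1-σ) := by positivity
  set α := 1-σ with hαd
  set β := 1-σ' with hβd
  set κ := K₀ * Real.Gamma α with hκd
  set E : (ℝ → ℝ) → ℝ → ENNReal :=
    fun x => (Set.Ici (0:ℝ)).indicator (fun y => ENNReal.ofReal (x y)) with hE
  have hE0 : ∀ x : ℝ → ℝ, ∀ y < 0, E x y = 0 := fun x y hy =>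
    Set.indicator_of_notMem (by simpa using hy) _
  have hEp : ∀ x : ℝ → ℝ, ∀ y, 0 ≤ y → E x y = ENNReal.ofReal (x y) := fun x y hy =>
    Set.indicator_of_mem (Set.mem_Ici.2 hy) _
  have hP := gwP_meas c
  set d := ENNReal.ofReal (Real.Gamma β) with hd
  have hm : ∀ t, E f t ≤ E g t + d * (E h ⋆ₗ gwP c β) t
      + ENNReal.ofReal κ * (E f ⋆ₗ gwP c α) t := by
    intro t
    rcases lt_or_ge t 0 with ht | ht
    · rw [hE0 f t ht]; exact zero_le
    rw [hEp f t ht, hEp g t ht]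
    refine (ENNReal.ofReal_le_ofReal (hmain t ht)).trans ?_
    refine ENNReal.ofReal_add_le.trans ?_
    have h1 := gw_hyp_conv (x := h) (k := k₁) (kE := fun u => d * gwP c β u)
      (fun u hu => by rw [gwP_nonpos c β hu, mul_zero])
      (fun u hu => by
        rw [hk₁, if_pos hu]
        refine ⟨by positivity, ?_⟩
        rw [gwP_pos c β hu, ← ENNReal.ofReal_mul hGβ.le, show β - 1 = -σ' by rw [hβd]; ring]
        congr 1
        field_simp) hh0 ht
    have h2 := gw_hyp_conv (x := f) (k := k₂) (kE := fun u => ENNReal.ofReal κ * gwP c α u)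
      (fun u hu => by rw [gwP_nonpos c α hu, mul_zero])
      (fun u hu => by
        rw [hk₂, if_pos hu]
        refine ⟨by positivity, ?_⟩
        rw [gwP_pos c α hu, ← ENNReal.ofReal_mul hκ.le, show α - 1 = -σ by rw [hαd]; ring]
        congr 1
        rw [hκd]
        field_simp) hf0 ht
    rw [gw_const_conv _ (gw_toE_meas hhm) (hP _)] at h1
    rw [gw_const_conv _ (gw_toE_meas hfm) (hP _)] at h2
    exact add_le_add (ENNReal.ofReal_add_le.trans (add_le_add_right h1 _)) h2
  intro t ht
  have key := gw_abstract c hα hβ hκ d (gw_toE_meas hfm) (gw_toE_meas hgm) (gw_toE_meas hhm)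
    (hE0 f) (gw_locbd c hfloc) hm t
  have e2 : (fun u => ∑' n : ℕ, ENNReal.ofReal κ ^ (n+1) * gwP c ((n+1)*α) u) =
      fun u => ∑' n : ℕ, ENNReal.ofReal κ * (ENNReal.ofReal κ ^ n * gwP c (n*α+α) u) := by
    ext u
    congr 1
    ext n
    rw [show ((n:ℝ)+1)*α = n*α+α by ring]
    ring
  rw [e2] at key
  set KB2 : ℝ → ENNReal :=
    fun u => ∑' n : ℕ, ENNReal.ofReal κ * (ENNReal.ofReal κ ^ n * gwP c (n*α+α) u) with hKB2
  set KB1 : ℝ → ENNReal :=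
    fun u => ∑' n : ℕ, d * (ENNReal.ofReal κ ^ n * gwP c (n*α+β) u) with hKB1
  have hfin2 : (E g ⋆ₗ KB2) t ≠ ⊤ := gw_fin_conv c hα hα hκ ENNReal.ofReal_ne_top
    (gw_toE_meas hgm) (hE0 g) (gw_locbd c hgloc) t
  have hfin1 : (E h ⋆ₗ KB1) t ≠ ⊤ := gw_fin_conv c hα hβ hκ ENNReal.ofReal_ne_top
    (gw_toE_meas hhm) (hE0 h) (gw_locbd c hhloc) t
  have hKB2m : Measurable KB2 := Measurable.ennreal_tsum fun n => by
    have := hP (n*α+α)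
    fun_prop
  have hKB1m : Measurable KB1 := Measurable.ennreal_tsum fun n => by
    have := hP (n*α+β)
    fun_prop
  have hKB2p : ∀ u, 0 < u → 0 ≤ kb₂ u ∧ KB2 u = ENNReal.ofReal (kb₂ u) := by
    intro u hu
    have h1 := gw_series c hα hα hκ hκ.le hu
    have e : kb₂ u = Real.exp (-(c*u)) * u ^ (α-1) *
        ∑' n : ℕ, κ^n * κ / Real.Gamma ((n:ℝ)*α + α) * u ^ ((n:ℝ)*α) := by
      rw [hkb₂ u hu, show α - 1 = -σ by rw [hαd]; ring]
      congr 2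
      ext n
      rw [pow_succ, show ((n:ℝ)+1)*α = n*α+α by ring]
    rw [e]
    exact h1
  have hKB1p : ∀ u, 0 < u → 0 ≤ kb₁ u ∧ KB1 u = ENNReal.ofReal (kb₁ u) := by
    intro u hu
    have h1 := gw_series c hα hβ hκ hGβ.le hu
    rw [hkb₁ u hu, show -σ' = β - 1 by rw [hβd]; ring]
    exact h1
  have hI : (E g ⋆ₗ KB2) t + (E h ⋆ₗ KB1) t = ∫⁻ y in Set.Ioo 0 t,
      (ENNReal.ofReal (g y) * KB2 (-y+t) + ENNReal.ofReal (h y) * KB1 (-y+t)) := by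
    rw [gw_restrict (fun u hu => by simp [hKB2, gwP_nonpos c _ hu]),
      gw_restrict (fun u hu => by simp [hKB1, gwP_nonpos c _ hu]),
      lintegral_add_left (by fun_prop)]
  have hJ : ∫ u in (0:ℝ)..t, (kb₂ (t-u) * g u + kb₁ (t-u) * h u) =
      ((E g ⋆ₗ KB2) t + (E h ⋆ₗ KB1) t).toReal := by
    rw [hI, ← integral_toReal (by fun_prop), intervalIntegral.integral_of_le ht,
      integral_Ioc_eq_integral_Ioo]
    · refine setIntegral_congr_fun measurableSet_Ioo fun y hy => ?_
      have hp : 0 < -y + t := by linarith [hy.2]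
      have h1 := hKB1p _ hp
      have h2 := hKB2p _ hp
      have h3 := hg0 y hy.1.le
      have h4 := hh0 y hy.1.le
      rw [h1.2, h2.2, ← ENNReal.ofReal_mul h3, ← ENNReal.ofReal_mul h4,
        ← ENNReal.ofReal_add (mul_nonneg h3 h2.1) (mul_nonneg h4 h1.1),
        ENNReal.toReal_ofReal (add_nonneg (mul_nonneg h3 h2.1) (mul_nonneg h4 h1.1)),
        show t - y = -y + t by ring]
      ring
    · refine (ae_restrict_iff' measurableSet_Ioo).2 (Eventually.of_forall fun y hy => ?_)
      have hp : 0 < -y + t := by linarith [hy.2]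
      rw [(hKB1p _ hp).2, (hKB2p _ hp).2]
      simp [ENNReal.mul_lt_top]
  rw [hJ]
  have hfin : (E g ⋆ₗ KB2) t + (E h ⋆ₗ KB1) t ≠ ⊤ := ENNReal.add_ne_top.2 ⟨hfin2, hfin1⟩
  have key' : E f t ≤ E g t + ((E g ⋆ₗ KB2) t + (E h ⋆ₗ KB1) t) := key
  rw [hEp f t ht, hEp g t ht, ← ENNReal.ofReal_toReal hfin,
    ← ENNReal.ofReal_add (hg0 t ht) ENNReal.toReal_nonneg] at key'
  exact (ENNReal.ofReal_le_ofReal_iff (add_nonneg (hg0 t ht) ENNReal.toReal_nonneg)).1 key'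
end

section
/- For every σ ∈ (0,1), one has lim_{s → +∞} (1/s) · log( Σ_{n=0}^∞ Γ(1−σ)^{n+1} / Γ((n+1)(1−σ)) · s^{n(1−σ)} ) = Γ(1−σ)^{1/(1−σ)}. -/
open Filter Real

lemma ml_aux_gamma_lower {x y : ℝ} (hx : 0 < x) (hy : 0 < y) :
    y ^ x / Real.Gamma x ≤ x * Real.exp y := by
  have hG := Real.Gamma_pos_of_pos hx
  have h1 : y ^ x * Real.exp (-y) ≤ Real.Gamma (x + 1) := by
    have hint := Real.GammaIntegral_convergent (s := x + 1) (by linarith)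
    rw [Real.Gamma_eq_integral (by linarith)]
    have hsub : Set.Ioi y ⊆ Set.Ioi (0:ℝ) := Set.Ioi_subset_Ioi hy.le
    calc y ^ x * Real.exp (-y) = ∫ u in Set.Ioi y, Real.exp (-u) * y ^ x := by
          rw [MeasureTheory.integral_mul_const, integral_exp_neg_Ioi, mul_comm]
      _ ≤ ∫ u in Set.Ioi y, Real.exp (-u) * u ^ (x + 1 - 1) := by
          apply MeasureTheory.setIntegral_mono_on
          · exact (integrableOn_exp_neg_Ioi y).mul_const _
          · exact hint.mono_set hsub
          · exact measurableSet_Ioi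
          · intro u hu
            have hu' : y < u := hu
            rw [add_sub_cancel_right]
            gcongr
      _ ≤ ∫ u in Set.Ioi 0, Real.exp (-u) * u ^ (x + 1 - 1) := by
          apply MeasureTheory.setIntegral_mono_set hint
          · filter_upwards [MeasureTheory.ae_restrict_mem measurableSet_Ioi] with u hu
            have hu' : 0 < u := hu
            positivity
          · exact hsub.eventuallyLE
  rw [Real.Gamma_add_one hx.ne'] at h1
  rw [div_le_iff₀ hG]
  have h2 : y ^ x * Real.exp (-y) * Real.exp y ≤ x * Real.Gamma x * Real.exp y := by gcongr
  rw [mul_assoc, ← Real.exp_add] at h2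
  simp at h2
  linarith

lemma ml_aux_term {a t l : ℝ} (ha : 0 < a) (ht : 0 < t) (hl : 1 < l) (n : ℕ) :
    t ^ (((n:ℝ)+1)*a) / Real.Gamma (((n:ℝ)+1)*a)
      ≤ (((n:ℝ)+1) * (l ^ (-a)) ^ (n+1)) * (a * Real.exp (l * t)) := by
  have hl0 : 0 < l := by linarith
  have hx : 0 < ((n:ℝ)+1)*a := by positivity
  have h := ml_aux_gamma_lower hx (mul_pos hl0 ht)
  rw [Real.mul_rpow hl0.le ht.le] at h
  have e : (l ^ (-a)) ^ (n+1) = (l ^ (((n:ℝ)+1)*a))⁻¹ := by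
    rw [← Real.rpow_natCast, ← Real.rpow_mul hl0.le, ← Real.rpow_neg hl0.le]
    push_cast; ring_nf
  have hp : 0 < l ^ (((n:ℝ)+1)*a) := by positivity
  rw [e]
  set L := l ^ (((n:ℝ)+1)*a)
  set T := t ^ (((n:ℝ)+1)*a) / Real.Gamma (((n:ℝ)+1)*a) with hT
  rw [mul_div_assoc, ← hT] at h
  have : T ≤ (((n:ℝ)+1)*a * Real.exp (l*t)) / L := by
    rw [le_div_iff₀ hp]; linarith
  calc T ≤ _ := this
    _ = _ := by ring

lemma ml_aux_summable_geom {a l : ℝ} (ha : 0 < a) (hl : 1 < l) :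
    Summable (fun n : ℕ => ((n:ℝ)+1) * (l ^ (-a)) ^ (n+1)) := by
  have hr : ‖l ^ (-a)‖ < 1 := by
    rw [Real.norm_of_nonneg (by positivity)]
    exact Real.rpow_lt_one_of_one_lt_of_neg hl (by linarith)
  have h := summable_pow_mul_geometric_of_norm_lt_one 1 hr
  have := (summable_nat_add_iff 1).2 h
  simpa using this

lemma ml_aux_summable {a t : ℝ} (ha : 0 < a) (ht : 0 < t) :
    Summable (fun n : ℕ => t ^ (((n:ℝ)+1)*a) / Real.Gamma (((n:ℝ)+1)*a)) := by
  refine Summable.of_nonneg_of_le (fun n => ?_)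
    (fun n => ml_aux_term ha ht (l := 2) (by norm_num) n)
    ((ml_aux_summable_geom ha (by norm_num)).mul_right _)
  have := Real.Gamma_pos_of_pos (show 0 < ((n:ℝ)+1)*a by positivity)
  positivity

lemma ml_aux_upper {a l : ℝ} (ha : 0 < a) (hl : 1 < l) :
    ∃ C : ℝ, 0 < C ∧ ∀ t : ℝ, 0 < t →
      ∑' n : ℕ, t ^ (((n:ℝ)+1)*a) / Real.Gamma (((n:ℝ)+1)*a) ≤ C * Real.exp (l * t) := by
  have hl0 : 0 < l := by linarith
  have hs := ml_aux_summable_geom ha hl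
  refine ⟨(∑' n : ℕ, ((n:ℝ)+1) * (l ^ (-a)) ^ (n+1)) * a, ?_, fun t ht => ?_⟩
  · refine mul_pos (hs.tsum_pos (fun n => by positivity) 0 (by positivity)) ha
  · rw [mul_assoc, ← tsum_mul_right]
    exact (ml_aux_summable ha ht).tsum_le_tsum (fun n => ml_aux_term ha ht hl n)
      (hs.mul_right _)

lemma ml_aux_lower {a t : ℝ} (ha : 0 < a) (ha1 : a < 1) (ht : 1 ≤ t) :
    Real.exp t - 1 - t ≤ ∑' n : ℕ, t ^ (((n:ℝ)+1)*a) / Real.Gamma (((n:ℝ)+1)*a) := by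
  have ht0 : 0 < t := by linarith
  have hexp : HasSum (fun n : ℕ => t ^ n / (n.factorial : ℝ)) (Real.exp t) := by
    rw [Real.exp_eq_exp_ℝ]; exact NormedSpace.expSeries_div_hasSum_exp t
  have h2 : HasSum (fun n : ℕ => t ^ (n+2) / ((n+2).factorial : ℝ)) (Real.exp t - 1 - t) := by
    have := (hasSum_nat_add_iff' 2).2 hexp
    simpa [Finset.sum_range_succ, sub_sub] using this
  have hk : ∀ m : ℕ, ∃ n : ℕ, ((m:ℝ)+2) ≤ ((n:ℝ)+1)*a ∧ ((n:ℝ)+1)*a < (m:ℝ)+3 := by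
    intro m
    have hpos : 0 < ((m:ℝ)+2)/a := by positivity
    obtain ⟨n, hn⟩ := Nat.exists_eq_succ_of_ne_zero (Nat.ceil_pos.2 hpos).ne'
    have h1 := Nat.le_ceil (((m:ℝ)+2)/a)
    have h3 := Nat.ceil_lt_add_one hpos.le
    rw [hn] at h1 h3
    push_cast at h1 h3
    rw [div_le_iff₀ ha] at h1
    refine ⟨n, h1, ?_⟩
    have h4 : (n:ℝ) < ((m:ℝ)+2)/a := by linarith
    rw [lt_div_iff₀ ha] at h4
    linarith
  choose k hk1 hk2 using hk
  have hinj : Function.Injective k := by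
    intro m m' h
    have e1 := hk1 m
    have e2 := hk2 m
    have e3 := hk1 m'
    have e4 := hk2 m'
    rw [h] at e1 e2
    have f1 : (m:ℝ) < (m':ℝ) + 1 := by linarith
    have f2 : (m':ℝ) < (m:ℝ) + 1 := by linarith
    norm_cast at f1 f2
    omega
  rw [← h2.tsum_eq]
  refine Summable.tsum_le_tsum_of_inj k hinj (fun n _ => ?_) (fun m => ?_) h2.summable
    (ml_aux_summable ha ht0)
  · have := Real.Gamma_pos_of_pos (show 0 < ((n:ℝ)+1)*a by positivity)
    positivity
  · have e1 := hk1 m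
    have e2 := hk2 m
    have hm : (0:ℝ) ≤ m := by positivity
    have hG := Real.Gamma_pos_of_pos (show 0 < ((k m:ℝ)+1)*a by positivity)
    have hle : Real.Gamma (((k m:ℝ)+1)*a) ≤ ((m+2).factorial : ℝ) := by
      rw [← Real.Gamma_nat_eq_factorial]
      apply Real.Gamma_strictMonoOn_Ici.monotoneOn
      · show (2:ℝ) ≤ _
        linarith
      · show (2:ℝ) ≤ _
        push_cast; linarith
      · push_cast; linarith
    have hpw : t ^ (m+2) ≤ t ^ (((k m:ℝ)+1)*a) := by
      rw [← Real.rpow_natCast]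
      apply Real.rpow_le_rpow_of_exponent_le ht
      push_cast; exact e1
    gcongr

lemma ml_aux_limit {a : ℝ} (ha : 0 < a) (ha1 : a < 1) :
    Tendsto (fun t : ℝ => Real.log
      (∑' n : ℕ, t ^ (((n:ℝ)+1)*a) / Real.Gamma (((n:ℝ)+1)*a)) / t) atTop (nhds 1) := by
  rw [tendsto_order]
  constructor
  · intro b hb
    filter_upwards [eventually_ge_atTop 4, eventually_gt_atTop (Real.log 2 / (1 - b))]
      with t ht4 ht
    have hl := ml_aux_lower ha ha1 (show 1 ≤ t by linarith)
    have hq := Real.quadratic_le_exp_of_nonneg (show 0 ≤ t by linarith)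
    have h1 : Real.exp t / 2 ≤
        ∑' n : ℕ, t ^ (((n:ℝ)+1)*a) / Real.Gamma (((n:ℝ)+1)*a) := by nlinarith
    have h2 := Real.log_le_log (by positivity) h1
    rw [Real.log_div (by positivity) (by norm_num), Real.log_exp] at h2
    rw [div_lt_iff₀ (by linarith)] at ht
    rw [lt_div_iff₀ (by linarith)]
    linarith
  · intro b hb
    obtain ⟨C, hC, hU⟩ := ml_aux_upper ha (show 1 < (1 + b)/2 by linarith)
    filter_upwards [eventually_ge_atTop 4, eventually_gt_atTop (Real.log C / ((b - 1)/2))]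
      with t ht4 ht
    have hl := ml_aux_lower ha ha1 (show 1 ≤ t by linarith)
    have hq := Real.quadratic_le_exp_of_nonneg (show 0 ≤ t by linarith)
    have h2 := Real.log_le_log (by nlinarith) (hU t (by linarith))
    rw [Real.log_mul hC.ne' (by positivity), Real.log_exp] at h2
    rw [div_lt_iff₀ (by linarith)] at ht
    rw [div_lt_iff₀ (by linarith)]
    linarith

/-- Exponential growth rate of the Mittag-Leffler-type series (equation (3.4)
of the paper): (1/s) log ( ∑ₙ Γ(1−σ)^{n+1} / Γ((n+1)(1−σ)) · s^{n(1−σ)} )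
tends to Γ(1−σ)^{1/(1−σ)} as s → ∞. -/
theorem mittag_leffler_growth_rate (σ : ℝ) (hσ : σ ∈ Set.Ioo (0:ℝ) 1) :
    Tendsto (fun s : ℝ => (1/s) * Real.log (∑' n : ℕ,
        Real.Gamma (1-σ) ^ (n+1) / Real.Gamma (((n:ℝ)+1)*(1-σ)) * s ^ ((n:ℝ)*(1-σ))))
      atTop (nhds (Real.Gamma (1-σ) ^ ((1:ℝ)/(1-σ)))) := by
  obtain ⟨h0, h1⟩ := hσ
  have ha : 0 < 1 - σ := by linarith
  have ha1 : 1 - σ < 1 := by linarith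
  generalize 1 - σ = a at *
  have hG := Real.Gamma_pos_of_pos ha
  set G := Real.Gamma a with hGdef
  set c := G ^ ((1:ℝ)/a) with hc
  have hc0 : 0 < c := by positivity
  have hca : c ^ a = G := by
    rw [hc, ← Real.rpow_mul hG.le, one_div_mul_cancel ha.ne', Real.rpow_one]
  have hlim := (ml_aux_limit ha ha1).comp (tendsto_id.const_mul_atTop hc0)
  have hlog : Tendsto (fun s : ℝ => Real.log s / s) atTop (nhds 0) := by
    simpa using Real.tendsto_pow_log_div_mul_add_atTop 1 0 1 one_ne_zero
  have hfin := (hlim.const_mul c).sub (hlog.const_mul a)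
  simp only [mul_one, mul_zero, sub_zero] at hfin
  refine hfin.congr' ?_
  filter_upwards [eventually_ge_atTop 1, eventually_ge_atTop (4 / c)] with s hs hs4
  have hs0 : 0 < s := by linarith
  rw [div_le_iff₀ hc0] at hs4
  have hsum : ∑' n : ℕ, G ^ (n+1) / Real.Gamma (((n:ℝ)+1)*a) * s ^ ((n:ℝ)*a)
      = s ^ (-a) * ∑' n : ℕ, (c*s) ^ (((n:ℝ)+1)*a) / Real.Gamma (((n:ℝ)+1)*a) := by
    rw [← tsum_mul_left]
    congr 1
    ext n
    have e1 : c ^ (((n:ℝ)+1)*a) = G ^ (n+1) := by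
      rw [← hca, ← Real.rpow_natCast, ← Real.rpow_mul hc0.le]
      push_cast; ring_nf
    have e2 : s ^ ((n:ℝ)*a) = s ^ (-a) * s ^ (((n:ℝ)+1)*a) := by
      rw [← Real.rpow_add hs0]; ring_nf
    rw [Real.mul_rpow hc0.le hs0.le, e1, e2]
    ring
  have hH : 0 < ∑' n : ℕ, (c*s) ^ (((n:ℝ)+1)*a) / Real.Gamma (((n:ℝ)+1)*a) := by
    have hl := ml_aux_lower ha ha1 (show 1 ≤ c * s by linarith)
    have hq := Real.quadratic_le_exp_of_nonneg (show 0 ≤ c * s by linarith)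
    nlinarith
  rw [hsum, Real.log_mul (by positivity) hH.ne', Real.log_rpow hs0]
  simp only [Function.comp, id]
  generalize (∑' n : ℕ, (c*s) ^ (((n:ℝ)+1)*a) / Real.Gamma (((n:ℝ)+1)*a)) = H
  field_simp
  ring
end

section
/- Let σ ∈ (0,1). For every real x ≥ 1, one has Σ_{n=0}^∞ x^{n(1−σ)} / Γ(n(1−σ) + 1) ≤ ⌊1/(1−σ) + 1⌋ · x · e^x. -/
open Real

namespace MLB

lemma gamma_low {θ : ℝ} (h0 : 0 < θ) (h1 : θ < 1) : 4/5 ≤ Real.Gamma (θ + 1) := by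
  have h := Real.Gamma_mul_add_mul_le_rpow_Gamma_mul_rpow_Gamma (s := θ + 2) (t := θ + 1)
    (a := 1 - θ) (b := θ) (by linarith) (by linarith) (by linarith) h0 (by ring)
  have e : (1 - θ) * (θ + 2) + θ * (θ + 1) = 2 := by ring
  have hg : 0 < Real.Gamma (θ + 1) := Real.Gamma_pos_of_pos (by linarith)
  have e2 : Real.Gamma (θ + 2) = (1 + θ) * Real.Gamma (θ + 1) := by
    rw [show θ + 2 = (θ + 1) + 1 by ring, Real.Gamma_add_one (by linarith)]; ring
  rw [e, Real.Gamma_two, e2, Real.mul_rpow (by linarith) hg.le, mul_assoc,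
    ← Real.rpow_add hg, show 1 - θ + θ = 1 by ring, Real.rpow_one] at h
  have b := rpow_one_add_le_one_add_mul_self (s := θ) (p := 1 - θ) (by linarith)
    (by linarith) (by linarith)
  have b2 : (1 + θ) ^ (1 - θ) ≤ 5/4 := by nlinarith [sq_nonneg (θ - 1/2)]
  nlinarith

lemma gamma_mono {a b : ℝ} (ha : 2 ≤ a) (h : a ≤ b) : Real.Gamma a ≤ Real.Gamma b :=
  Real.Gamma_strictMonoOn_Ici.monotoneOn (by simpa using ha) (by simpa using ha.trans h) h

lemma sqrt_pi_low : (1.772 : ℝ) ≤ √π := by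
  apply Real.le_sqrt_of_sq_le
  have := Real.pi_gt_d4
  norm_num at *
  linarith

lemma g52 : (1.329 : ℝ) ≤ Real.Gamma (5/2) := by
  rw [show (5/2:ℝ) = (1/2 + 1) + 1 by norm_num, Real.Gamma_add_one (by norm_num),
    Real.Gamma_add_one (by norm_num), Real.Gamma_one_half_eq]
  have := sqrt_pi_low
  norm_num at *
  linarith

lemma g72 : (3.322 : ℝ) ≤ Real.Gamma (7/2) := by
  rw [show (7/2:ℝ) = 5/2 + 1 by norm_num, Real.Gamma_add_one (by norm_num)]
  have := g52
  norm_num at *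
  linarith

lemma g92 : (11.627 : ℝ) ≤ Real.Gamma (9/2) := by
  rw [show (9/2:ℝ) = 7/2 + 1 by norm_num, Real.Gamma_add_one (by norm_num)]
  have := g72
  norm_num at *
  linarith

/-- slack of group m -/
noncomputable def d (m : ℕ) : ℝ :=
  if m = 1 then 0.24 else if m = 2 then 0.19 else if m = 3 then 0.08 else 0

lemma d_nonneg (m : ℕ) : 0 ≤ d m := by
  unfold d; split_ifs <;> norm_num

lemma pow_bd {x y : ℝ} {m : ℕ} (hx : 1 ≤ x) (hy : y < m + 1) : x ^ (y - 1) ≤ x ^ m := by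
  rw [← Real.rpow_natCast]
  exact Real.rpow_le_rpow_of_exponent_le hx (by linarith)

lemma term_w {x y : ℝ} {m : ℕ} (hx : 1 ≤ x) (hm : 1 ≤ m) (h : (m:ℝ) ≤ y) (hy : y < m + 1) :
    x ^ (y - 1) / Real.Gamma (y + 1) ≤ x ^ m / (m.factorial : ℝ) := by
  have hm' : (1:ℝ) ≤ m := by exact_mod_cast hm
  have : (m.factorial : ℝ) ≤ Real.Gamma (y + 1) := by
    rw [← Real.Gamma_nat_eq_factorial]
    exact gamma_mono (by linarith) (by linarith)
  have := pow_bd hx hy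
  have : (0:ℝ) < m.factorial := by exact_mod_cast m.factorial_pos
  gcongr

lemma aux {X f D G g : ℝ} (hX : 1 ≤ X) (hf : 0 < f) (hg : 0 < g) (h : g ≤ G)
    (hD : D + 1 / g ≤ 1 / f) (hD0 : 0 ≤ D) {P : ℝ} (hP : P ≤ X) : P / G ≤ X / f - D := by
  have h1 : P / G ≤ X / g := by gcongr
  have : X / g = X * (1 / g) := by ring
  have : X / f = X * (1 / f) := by ring
  nlinarith

lemma term_u {x y : ℝ} {m : ℕ} (hx : 1 ≤ x) (hm : 1 ≤ m) (h : (m:ℝ) + 1/2 ≤ y)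
    (hy : y < m + 1) :
    x ^ (y - 1) / Real.Gamma (y + 1) ≤ x ^ m / (m.factorial : ℝ) - d m := by
  have hX : 1 ≤ x ^ m := one_le_pow₀ hx
  have hP := pow_bd hx hy
  by_cases h1 : m = 1
  · subst h1
    push_cast at h hy
    refine aux hX (by norm_num) (by norm_num) (g52.trans (gamma_mono (by norm_num) (by linarith)))
      ?_ (d_nonneg _) hP
    norm_num [d]
  by_cases h2 : m = 2
  · subst h2
    push_cast at h hy
    refine aux hX (by norm_num) (by norm_num) (g72.trans (gamma_mono (by norm_num) (by linarith)))
      ?_ (d_nonneg _) hP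
    norm_num [d]
  by_cases h3 : m = 3
  · subst h3
    push_cast at h hy
    refine aux hX (by norm_num [Nat.factorial]) (by norm_num)
      (g92.trans (gamma_mono (by norm_num) (by linarith))) ?_ (d_nonneg _) hP
    norm_num [d, Nat.factorial]
  · have : d m = 0 := by simp [d, h1, h2, h3]
    rw [this, sub_zero]
    exact term_w hx hm (by linarith) hy

lemma d_le {x : ℝ} (hx : 1 ≤ x) (m : ℕ) : d m ≤ x ^ m / (m.factorial : ℝ) := by
  have hX : 1 ≤ x ^ m := one_le_pow₀ hx
  have : 1 / (m.factorial : ℝ) ≤ x ^ m / (m.factorial : ℝ) := by gcongr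
  refine le_trans ?_ this
  unfold d
  split_ifs with h1 h2 h3
  · subst h1; norm_num
  · subst h2; norm_num
  · subst h3; norm_num [Nat.factorial]
  · positivity

lemma card_bd {α a L : ℝ} (hα : 0 < α) (S : Finset ℕ)
    (h : ∀ n ∈ S, a ≤ (n:ℝ) * α ∧ (n:ℝ) * α < a + L) : S.card ≤ ⌈L / α⌉₊ := by
  have hs : S ⊆ Finset.Ico ⌈a / α⌉₊ ⌈(a + L) / α⌉₊ := by
    intro n hn
    obtain ⟨h1, h2⟩ := h n hn
    rw [Finset.mem_Ico, Nat.ceil_le, Nat.lt_ceil, div_le_iff₀ hα, lt_div_iff₀ hα]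
    exact ⟨h1, h2⟩
  have := Finset.card_le_card hs
  rw [Nat.card_Ico, add_div] at this
  have := Nat.ceil_add_le (a / α) (L / α)
  omega

lemma group_bd {α x : ℝ} (hα : 0 < α) (hx : 1 ≤ x) {m : ℕ} (hm : 1 ≤ m) (N : ℕ)
    (hN : ⌈1 / α⌉₊ ≤ N) (hN2 : 2 * ⌈(1/2) / α⌉₊ ≤ N + 1) (S : Finset ℕ)
    (h : ∀ n ∈ S, (m:ℝ) ≤ (n:ℝ) * α ∧ (n:ℝ) * α < m + 1) :
    ∑ n ∈ S, x ^ ((n:ℝ) * α - 1) / Real.Gamma ((n:ℝ) * α + 1)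
      ≤ N * (x ^ m / (m.factorial : ℝ)) - ((N:ℝ) - 1) / 2 * d m := by
  classical
  set w := x ^ m / (m.factorial : ℝ) with hw
  have hc : S.card ≤ N := (card_bd hα S h).trans hN
  set L := S.filter (fun n : ℕ => (n:ℝ) * α < m + 1/2) with hL
  set U := S.filter (fun n : ℕ => ¬ (n:ℝ) * α < m + 1/2) with hU
  have hcL : 2 * L.card ≤ N + 1 := by
    have := card_bd (a := m) (L := 1/2) hα L (by
      intro n hn
      rw [hL, Finset.mem_filter] at hn
      exact ⟨(h n hn.1).1, hn.2⟩)
    omega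
  have hsum : L.card + U.card = S.card := Finset.card_filter_add_card_filter_not _
  rw [← Finset.sum_filter_add_sum_filter_not S (fun n : ℕ => (n:ℝ) * α < m + 1/2)]
  have s1 : ∑ n ∈ L, x ^ ((n:ℝ) * α - 1) / Real.Gamma ((n:ℝ) * α + 1) ≤ L.card • w := by
    apply Finset.sum_le_card_nsmul
    intro n hn
    rw [hL, Finset.mem_filter] at hn
    exact term_w hx hm (h n hn.1).1 (h n hn.1).2
  have s2 : ∑ n ∈ U, x ^ ((n:ℝ) * α - 1) / Real.Gamma ((n:ℝ) * α + 1)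
      ≤ U.card • (w - d m) := by
    apply Finset.sum_le_card_nsmul
    intro n hn
    rw [hU, Finset.mem_filter] at hn
    exact term_u hx hm (not_lt.1 hn.2) (h n hn.1).2
  rw [nsmul_eq_mul] at s1 s2
  have hd := d_le hx m
  rw [← hw] at hd
  have hd0 := d_nonneg m
  have c1 : (L.card : ℝ) + U.card ≤ N := by exact_mod_cast hsum ▸ hc
  have c2 : 2 * (L.card : ℝ) ≤ N + 1 := by exact_mod_cast hcL
  nlinarith [mul_nonneg (sub_nonneg.2 c1) (sub_nonneg.2 hd), mul_nonneg (sub_nonneg.2 c2) hd0]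

lemma group_zero {α x : ℝ} (hα : 0 < α) (hx : 1 ≤ x) (N : ℕ)
    (hN : ⌈1 / α⌉₊ ≤ N) (S : Finset ℕ) (h0 : 0 ∈ S)
    (h : ∀ n ∈ S, (n:ℝ) * α < 1) :
    ∑ n ∈ S, x ^ ((n:ℝ) * α - 1) / Real.Gamma ((n:ℝ) * α + 1)
      ≤ N + ((N:ℝ) - 1) / 4 := by
  classical
  have hc : S.card ≤ N := (card_bd (a := 0) hα S (fun n hn =>
    ⟨by positivity, by simpa using h n hn⟩)).trans hN
  have hx1 : ∀ y : ℝ, y < 1 → x ^ (y - 1) ≤ 1 := fun y hy =>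
    Real.rpow_le_one_of_one_le_of_nonpos hx (by linarith)
  rw [← Finset.add_sum_erase S _ h0]
  have s : ∑ n ∈ S.erase 0, x ^ ((n:ℝ) * α - 1) / Real.Gamma ((n:ℝ) * α + 1)
      ≤ (S.erase 0).card • (5/4 : ℝ) := by
    apply Finset.sum_le_card_nsmul
    intro n hn
    rw [Finset.mem_erase] at hn
    have hn0 : (0:ℝ) < n := by exact_mod_cast Nat.pos_of_ne_zero hn.1
    have g := gamma_low (mul_pos hn0 hα) (h n hn.2)
    rw [div_le_iff₀ (by linarith)]
    have := hx1 _ (h n hn.2)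
    linarith
  have e : (S.erase 0).card + 1 = S.card := Finset.card_erase_add_one h0
  have e' : ((S.erase 0).card : ℝ) + 1 ≤ N := by exact_mod_cast e ▸ hc
  rw [nsmul_eq_mul] at s
  have z := hx1 0 (by norm_num)
  simp only [Nat.cast_zero, zero_mul, zero_add, Real.Gamma_one, div_one]
  refine (add_le_add z s).trans ?_
  linarith

lemma partial_bd {α x : ℝ} (hα : 0 < α) (hα1 : α < 1) (hx : 1 ≤ x) (N : ℕ) (hN1 : 1 ≤ N)
    (hN : ⌈1 / α⌉₊ ≤ N) (hN2 : 2 * ⌈(1/2) / α⌉₊ ≤ N + 1) (M : ℕ) (hM : 0 < M) :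
    ∑ n ∈ Finset.range M, x ^ ((n:ℝ) * α - 1) / Real.Gamma ((n:ℝ) * α + 1)
      ≤ N * Real.exp x := by
  classical
  have hmaps : ∀ n ∈ Finset.range M, ⌊(n:ℝ) * α⌋₊ ∈ Finset.range (4 + M) := by
    intro n hn
    rw [Finset.mem_range] at hn ⊢
    have : ⌊(n:ℝ) * α⌋₊ ≤ n := by
      apply Nat.floor_le_of_le
      nlinarith [Nat.cast_nonneg (α := ℝ) n]
    omega
  rw [← Finset.sum_fiberwise_of_maps_to hmaps]
  let D : ℕ → ℝ := fun m => if m = 0 then -(((N:ℝ) - 1) / 4) else ((N:ℝ) - 1) / 2 * d m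
  have key : ∀ m ∈ Finset.range (4 + M),
      ∑ n ∈ (Finset.range M).filter (fun n : ℕ => ⌊(n:ℝ) * α⌋₊ = m),
        x ^ ((n:ℝ) * α - 1) / Real.Gamma ((n:ℝ) * α + 1)
      ≤ N * (x ^ m / (m.factorial : ℝ)) - D m := by
    intro m _
    have hf : ∀ n ∈ (Finset.range M).filter (fun n : ℕ => ⌊(n:ℝ) * α⌋₊ = m),
        (m:ℝ) ≤ (n:ℝ) * α ∧ (n:ℝ) * α < m + 1 := by
      intro n hn
      rw [Finset.mem_filter] at hn
      exact (Nat.floor_eq_iff (by positivity)).1 hn.2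
    rcases Nat.eq_zero_or_pos m with h | h
    · subst h
      have := group_zero hα hx N hN ((Finset.range M).filter (fun n : ℕ => ⌊(n:ℝ) * α⌋₊ = 0))
        (by simp [hM]) (fun n hn => by have := (hf n hn).2; rwa [Nat.cast_zero, zero_add] at this)
      simpa [D] using this
    · have := group_bd hα hx h N hN hN2 _ hf
      simpa [D, h.ne'] using this
  refine (Finset.sum_le_sum key).trans ?_
  rw [Finset.sum_sub_distrib, ← Finset.mul_sum]
  have hexp := Real.sum_le_exp_of_nonneg (by linarith : 0 ≤ x) (4 + M)
  have hD : 0 ≤ ∑ m ∈ Finset.range (4 + M), D m := by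
    rw [Finset.sum_range_add]
    have : ∀ i ∈ Finset.range M, D (4 + i) = 0 := by
      intro i _
      have : d (4 + i) = 0 := by
        unfold d; rw [if_neg (by omega), if_neg (by omega), if_neg (by omega)]
      simp only [D]; rw [if_neg (by omega), this, mul_zero]
    rw [Finset.sum_eq_zero this]
    have : (1:ℝ) ≤ N := by exact_mod_cast hN1
    simp [Finset.sum_range_succ, D, d]
    norm_num
    linarith
  have := mul_le_mul_of_nonneg_left hexp (Nat.cast_nonneg (α := ℝ) N)
  linarith

end MLB

/-- Elementary bound on a Mittag-Leffler-type series: for x ≥ 1,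
∑ₙ x^{n(1−σ)} / Γ(n(1−σ)+1) ≤ ⌊1/(1−σ)+1⌋ · x · eˣ. -/
theorem mittag_leffler_elementary_bound (σ : ℝ) (hσ : σ ∈ Set.Ioo (0:ℝ) 1) :
    ∀ x : ℝ, 1 ≤ x →
      (∑' n : ℕ, x ^ ((n:ℝ)*(1-σ)) / Real.Gamma ((n:ℝ)*(1-σ) + 1))
        ≤ (⌊1/(1-σ) + 1⌋ : ℝ) * x * Real.exp x := by
  intro x hx
  obtain ⟨h0, h1⟩ := hσ
  have hα : 0 < 1 - σ := by linarith
  have hα1 : 1 - σ < 1 := by linarith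
  generalize 1 - σ = α at hα hα1
  have hx0 : 0 < x := by linarith
  have hinv : 0 ≤ 1 / α := by positivity
  set K := ⌊1 / α⌋₊ with hK
  have hlt : 1 / α < K + 1 := Nat.lt_floor_add_one _
  have hfl : (⌊1 / α + 1⌋ : ℝ) = ((K + 1 : ℕ) : ℝ) := by
    rw [Int.floor_add_one, ← Int.natCast_floor_eq_floor hinv]
    push_cast; rfl
  rw [hfl]
  have hN : ⌈1 / α⌉₊ ≤ K + 1 := Nat.ceil_le_floor_add_one _
  have hN2 : 2 * ⌈(1/2) / α⌉₊ ≤ (K + 1) + 1 := by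
    have : ⌈(1/2) / α⌉₊ ≤ K / 2 + 1 := by
      rw [Nat.ceil_le]
      have e : (1/2) / α = (1 / α) / 2 := by ring
      have : (K:ℝ) + 1 ≤ 2 * ((K / 2 : ℕ) : ℝ) + 2 := by
        exact_mod_cast (by omega : K + 1 ≤ 2 * (K / 2) + 2)
      push_cast
      rw [e]; linarith
    omega
  apply Real.tsum_le_of_sum_range_le
  · intro n
    have : 0 < Real.Gamma ((n:ℝ) * α + 1) := Real.Gamma_pos_of_pos (by positivity)
    positivity
  · intro M
    rcases Nat.eq_zero_or_pos M with h | h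
    · subst h; simp; positivity
    · have := MLB.partial_bd hα hα1 hx (K + 1) (by omega) hN hN2 M h
      have e : ∀ n ∈ Finset.range M, x ^ ((n:ℝ) * α) / Real.Gamma ((n:ℝ) * α + 1)
          = x * (x ^ ((n:ℝ) * α - 1) / Real.Gamma ((n:ℝ) * α + 1)) := by
        intro n _
        rw [Real.rpow_sub_one hx0.ne']
        field_simp
      rw [Finset.sum_congr rfl e, ← Finset.mul_sum]
      have := mul_le_mul_of_nonneg_left this hx0.le
      linarith
end

section
/- Let σ ∈ (0,1), let n ≥ 1 be an integer and let s < t be real numbers. Setting t₀ := s and t_{n+1} := t, one has ∫_{ s ≤ t₁ ≤ ⋯ ≤ tₙ ≤ t } ∏_{k=0}^{n} (t_{k+1} − t_k)^{-σ} dt₁ ⋯ dtₙ = (t−s)^{n(1−σ)−σ} · Γ(1−σ)^{n+1} / Γ((n+1)(1−σ)), where the integral is over the ordered simplex { (t₁,…,tₙ) ∈ ℝⁿ : s ≤ t₁ ≤ ⋯ ≤ tₙ ≤ t } with respect to n-dimensional Lebesgue measure. -/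
open MeasureTheory Real

/-- The extended sequence t₀ = s, t₁, …, tₙ, t_{n+1} = t built from a point
u = (t₁, …, tₙ) of the simplex. -/
def fullSeq (n : ℕ) (s t : ℝ) (u : Fin n → ℝ) : Fin (n+2) → ℝ :=
  Fin.snoc (Fin.cons s u) t

/-- power kernel, cut off at 0 -/
noncomputable def powK (p c x : ℝ) : ENNReal := if 0 < x then ENNReal.ofReal (c * x ^ p) else 0

lemma measurable_powK (p c : ℝ) : Measurable (powK p c) :=
  Measurable.ite measurableSet_Ioi (by fun_prop) (by fun_prop)

lemma lintegral_affine (f : ℝ → ENNReal) (s : ℝ) {d : ℝ} (hd : 0 < d) (hf : Measurable f) :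
    ∫⁻ x, f ((x - s) / d) = ENNReal.ofReal d * ∫⁻ x, f x := by
  rw [lintegral_sub_right_eq_self (fun x => f (x / d)) s]
  conv_lhs => rw [← Real.smul_map_volume_mul_left hd.ne']
  rw [lintegral_smul_measure, lintegral_map (by fun_prop) (by fun_prop), abs_of_pos hd]
  congr 1
  apply lintegral_congr
  intro x
  rw [mul_div_cancel_left₀ _ hd.ne']

lemma beta_conv (a b c c' s t : ℝ) (ha : 0 < a) (hb : 0 < b) (hc : 0 ≤ c) (hc' : 0 ≤ c') :
    ∫⁻ x, powK (a - 1) c (x - s) * powK (b - 1) c' (t - x)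
      = powK (a + b - 1) (c * c' * (Gamma a * Gamma b / Gamma (a + b))) (t - s) := by
  by_cases hst : s < t
  · have hd : 0 < t - s := sub_pos.2 hst
    have hB := ProbabilityTheory.beta_pos ha hb
    have key : ∀ x, powK (a - 1) c (x - s) * powK (b - 1) c' (t - x) =
        ENNReal.ofReal (c * c' * ProbabilityTheory.beta a b * (t - s) ^ (a + b - 2)) *
          ProbabilityTheory.betaPDF a b ((x - s) / (t - s)) := by
      intro x
      by_cases h1 : s < x
      · by_cases h2 : x < t
        · have h1' : 0 < x - s := sub_pos.2 h1
          have h2' : 0 < t - x := sub_pos.2 h2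
          rw [powK, powK, if_pos h1', if_pos h2', ProbabilityTheory.betaPDF_of_pos_lt_one
            (div_pos h1' hd) ((div_lt_one hd).2 (by linarith)),
            ← ENNReal.ofReal_mul (by positivity), ← ENNReal.ofReal_mul (by positivity)]
          congr 1
          have e : 1 - (x - s) / (t - s) = (t - x) / (t - s) := by field_simp; ring
          have e2 : (t - s) ^ (a + b - 2) = (t - s) ^ (a - 1) * (t - s) ^ (b - 1) := by
            rw [← Real.rpow_add hd]; congr 1; ring
          rw [e, Real.div_rpow h1'.le hd.le, Real.div_rpow h2'.le hd.le, e2]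
          have p1 := Real.rpow_pos_of_pos hd (a - 1)
          have p2 := Real.rpow_pos_of_pos hd (b - 1)
          field_simp
        · rw [ProbabilityTheory.betaPDF_eq_zero_of_one_le ((one_le_div hd).2 (by linarith))]
          simp [powK, h2]
      · rw [ProbabilityTheory.betaPDF_eq_zero_of_nonpos
          (div_nonpos_of_nonpos_of_nonneg (by linarith) hd.le)]
        simp [powK, h1]
    have hm : Measurable (ProbabilityTheory.betaPDF a b) :=
      (ProbabilityTheory.measurable_betaPDFReal a b).ennreal_ofReal
    simp_rw [key]
    rw [lintegral_const_mul _ (by fun_prop), lintegral_affine _ s hd hm,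
      ProbabilityTheory.lintegral_betaPDF_eq_one ha hb, mul_one,
      ← ENNReal.ofReal_mul (by positivity), powK, if_pos hd]
    congr 1
    have e : (t - s) ^ (a + b - 1) = (t - s) ^ (a + b - 2) * (t - s) := by
      rw [← Real.rpow_add_one hd.ne']; congr 1; ring
    rw [e, ProbabilityTheory.beta]
    ring
  · have : ∀ x, powK (a - 1) c (x - s) * powK (b - 1) c' (t - x) = 0 := by
      intro x
      by_cases h1 : s < x
      · have : ¬ x < t := by linarith
        simp [powK, this]
      · simp [powK, h1]
    rw [lintegral_congr this]
    simp [powK, hst]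

lemma fullSeq_cons (n : ℕ) (s t x : ℝ) (v : Fin n → ℝ) :
    fullSeq (n+1) s t (Fin.cons x v) = Fin.cons s (fullSeq n x t v) := by
  unfold fullSeq
  rw [Fin.cons_snoc_eq_snoc_cons]

lemma measurable_fullSeq (n : ℕ) (s t : ℝ) (k : Fin (n+2)) :
    Measurable (fun u : Fin n → ℝ => fullSeq n s t u k) := by
  unfold fullSeq
  refine Fin.lastCases ?_ (fun j => ?_) k
  · simp
  · simp only [Fin.snoc_castSucc]
    refine Fin.cases ?_ (fun i => ?_) j
    · simp
    · simp only [Fin.cons_succ]; fun_prop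

lemma lintegral_main (σ : ℝ) (hσ : σ < 1) (n : ℕ) : ∀ s t : ℝ,
    ∫⁻ u : Fin n → ℝ, ∏ k : Fin (n+1), powK (-σ) 1 (fullSeq n s t u k.succ - fullSeq n s t u k.castSucc)
      = powK ((n:ℝ)*(1-σ) - σ) (Gamma (1-σ) ^ (n+1) / Gamma (((n:ℝ)+1)*(1-σ))) (t - s) := by
  have h1 : 0 < 1 - σ := by linarith
  have hG := Real.Gamma_pos_of_pos h1
  induction n with
  | zero =>
    intro s t
    have hv : (volume : Measure (Fin 0 → ℝ)) Set.univ = 1 := by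
      rw [volume_pi, Measure.pi_univ]; simp
    simp [fullSeq, Fin.snoc, hG.ne', hv]
  | succ n ih =>
    intro s t
    have hmp := (volume_preserving_piFinSuccAbove (fun _ : Fin (n + 1) => ℝ) 0).symm
    have hmeas : ∀ (m : ℕ) (s t : ℝ), Measurable (fun u : Fin m → ℝ => ∏ k : Fin (m+1),
        powK (-σ) 1 (fullSeq m s t u k.succ - fullSeq m s t u k.castSucc)) := fun m s t =>
      Finset.measurable_prod _ fun k _ => (measurable_powK _ _).comp
        ((measurable_fullSeq _ _ _ _).sub (measurable_fullSeq _ _ _ _))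
    rw [← hmp.lintegral_comp (hmeas _ _ _), Measure.volume_eq_prod,
      lintegral_prod _ (by exact ((hmeas (n+1) s t).comp hmp.measurable).aemeasurable)]
    have hb : 0 < ((n:ℝ)+1)*(1-σ) := by positivity
    have hGb := Real.Gamma_pos_of_pos hb
    have e : ∀ x : ℝ, ∫⁻ v : Fin n → ℝ, ∏ k : Fin (n+1+1), powK (-σ) 1
        (fullSeq (n+1) s t ((MeasurableEquiv.piFinSuccAbove (fun _ => ℝ) 0).symm (x, v)) k.succ
        - fullSeq (n+1) s t ((MeasurableEquiv.piFinSuccAbove (fun _ => ℝ) 0).symm (x, v)) k.castSucc)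
        = powK ((1-σ) - 1) 1 (x - s) * powK (((n:ℝ)+1)*(1-σ) - 1)
          (Gamma (1-σ) ^ (n+1) / Gamma (((n:ℝ)+1)*(1-σ))) (t - x) := by
      intro x
      have e1 : ((n:ℝ)+1)*(1-σ) - 1 = (n:ℝ)*(1-σ) - σ := by ring
      have e2 : 1 - σ - 1 = -σ := by ring
      rw [e1, e2, ← ih x t, ← lintegral_const_mul _ (hmeas _ _ _)]
      apply lintegral_congr
      intro v
      have e3 : (MeasurableEquiv.piFinSuccAbove (fun _ : Fin (n+1) => ℝ) 0).symm (x, v)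
        = Fin.cons x v := by
        simp [MeasurableEquiv.piFinSuccAbove_symm_apply, Fin.insertNthEquiv]
      have e4 : fullSeq n x t v 0 = x := by
        unfold fullSeq
        rw [← Fin.castSucc_zero, Fin.snoc_castSucc, Fin.cons_zero]
      rw [e3, fullSeq_cons, Fin.prod_univ_succ]
      simp only [Fin.cons_succ, Fin.castSucc_zero, Fin.cons_zero, ← Fin.succ_castSucc, e4]
    refine (lintegral_congr e).trans ?_
    rw [beta_conv _ _ _ _ _ _ h1 hb zero_le_one (by positivity)]
    push_cast
    have e5 : (1 - σ) + ((n:ℝ)+1)*(1-σ) = ((n:ℝ)+1+1)*(1-σ) := by ring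
    rw [e5]
    congr 1
    · ring
    · field_simp; rw [← pow_succ]

/-- The n-fold iterated convolution of the weakly singular kernel u ↦ u^{-σ} 1_{u>0}:
∫_{s ≤ t₁ ≤ ⋯ ≤ tₙ ≤ t} ∏_{k=0}^{n} (t_{k+1} − t_k)^{-σ} dt₁ ⋯ dtₙ
  = (t−s)^{n(1−σ)−σ} Γ(1−σ)^{n+1} / Γ((n+1)(1−σ)),  with t₀ = s, t_{n+1} = t. -/
theorem iterated_kernel_convolution (σ : ℝ) (hσ : σ ∈ Set.Ioo (0:ℝ) 1)
    (n : ℕ) (hn : 1 ≤ n) (s t : ℝ) (hst : s < t) :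
    (∫ u in {u : Fin n → ℝ | ∀ i : Fin (n+1),
        fullSeq n s t u i.castSucc ≤ fullSeq n s t u i.succ},
      ∏ k : Fin (n+1), (fullSeq n s t u k.succ - fullSeq n s t u k.castSucc) ^ (-σ))
    = (t - s) ^ ((n:ℝ)*(1-σ) - σ) * Real.Gamma (1-σ) ^ (n+1) /
        Real.Gamma (((n:ℝ)+1)*(1-σ)) := by
  have h1 : 0 < 1 - σ := by linarith [hσ.2]
  have hd : 0 < t - s := sub_pos.2 hst
  have hG := Real.Gamma_pos_of_pos h1
  have hGb := Real.Gamma_pos_of_pos (show 0 < ((n:ℝ)+1)*(1-σ) by positivity)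
  have hS : MeasurableSet {u : Fin n → ℝ | ∀ i : Fin (n+1),
      fullSeq n s t u i.castSucc ≤ fullSeq n s t u i.succ} := by
    rw [Set.setOf_forall]
    exact MeasurableSet.iInter fun i =>
      measurableSet_le (measurable_fullSeq _ _ _ _) (measurable_fullSeq _ _ _ _)
  rw [integral_eq_lintegral_of_nonneg_ae]
  · rw [← lintegral_indicator hS]
    have key := lintegral_main σ hσ.2 n s t
    rw [powK, if_pos hd] at key
    rw [lintegral_congr (g := fun u => ∏ k : Fin (n+1),
      powK (-σ) 1 (fullSeq n s t u k.succ - fullSeq n s t u k.castSucc)), key,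
      ENNReal.toReal_ofReal (by positivity)]
    · ring
    · intro u
      by_cases hu : u ∈ {u : Fin n → ℝ | ∀ i : Fin (n+1),
        fullSeq n s t u i.castSucc ≤ fullSeq n s t u i.succ}
      · rw [Set.indicator_of_mem hu, ENNReal.ofReal_prod_of_nonneg
          fun k _ => Real.rpow_nonneg (sub_nonneg.2 (hu k)) _]
        refine Finset.prod_congr rfl fun k _ => ?_
        rcases (sub_nonneg.2 (hu k)).eq_or_lt with h | h
        · rw [← h, Real.zero_rpow (by linarith [hσ.1])]
          simp [powK]
        · rw [powK, if_pos h, one_mul]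
      · rw [Set.indicator_of_notMem hu]
        simp only [Set.mem_setOf_eq, not_forall, not_le] at hu
        obtain ⟨k, hk⟩ := hu
        refine (Finset.prod_eq_zero (Finset.mem_univ k) ?_).symm
        rw [powK, if_neg (by linarith)]
  · refine (ae_restrict_iff' hS).2 (Filter.Eventually.of_forall fun u hu => ?_)
    exact Finset.prod_nonneg fun k _ => Real.rpow_nonneg (sub_nonneg.2 (hu k)) _
  · exact (Finset.measurable_prod _ fun k _ =>
      ((measurable_fullSeq _ _ _ _).sub (measurable_fullSeq _ _ _ _)).pow_const _).aestronglyMeasurable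
end

section
/- Let σ, σ' ∈ (0,1), let n ≥ 1 be an integer and let s < t be real numbers. Setting t_{n+1} := t, one has ∫_{ s ≤ t₁ ≤ ⋯ ≤ tₙ ≤ t } (t₁ − s)^{-σ'} ∏_{k=1}^{n} (t_{k+1} − t_k)^{-σ} dt₁ ⋯ dtₙ = (t−s)^{n(1−σ)−σ'} · Γ(1−σ)ⁿ Γ(1−σ') / Γ(n(1−σ) + (1−σ')), where the integral is over the ordered simplex { (t₁,…,tₙ) ∈ ℝⁿ : s ≤ t₁ ≤ ⋯ ≤ tₙ ≤ t } with respect to n-dimensional Lebesgue measure. -/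
open MeasureTheory Real

def stepSet (n : ℕ) (s t : ℝ) : Set (Fin n → ℝ) := {u : Fin n → ℝ | ∀ i : Fin (n+1),
        fullSeq n s t u i.castSucc ≤ fullSeq n s t u i.succ}

noncomputable def kerF (σ σ' : ℝ) (n : ℕ) (s t : ℝ) (u : Fin n → ℝ) : ℝ :=
  (fullSeq n s t u 1 - fullSeq n s t u 0) ^ (-σ') *
        ∏ k : Fin n, (fullSeq n s t u k.succ.succ - fullSeq n s t u k.succ.castSucc) ^ (-σ)

noncomputable def kerG (σ σ' : ℝ) (n : ℕ) (s t : ℝ) : (Fin n → ℝ) → ENNReal :=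
  (stepSet n s t).indicator (fun u => ENNReal.ofReal (kerF σ σ' n s t u))

lemma fullSeq_meas (n : ℕ) (s t : ℝ) (i : Fin (n+2)) : Measurable (fun u => fullSeq n s t u i) := by
  unfold fullSeq
  refine Fin.lastCases ?_ (fun j => ?_) i
  · simp
  · simp only [Fin.snoc_castSucc]
    refine Fin.cases ?_ (fun k => ?_) j
    · simp
    · simp only [Fin.cons_succ]
      exact measurable_pi_apply k

lemma stepSet_meas (n : ℕ) (s t : ℝ) : MeasurableSet (stepSet n s t) := by
  unfold stepSet
  rw [Set.ofPred_forall]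
  exact MeasurableSet.iInter fun i => measurableSet_le (fullSeq_meas ..) (fullSeq_meas ..)

lemma kerF_meas (σ σ' : ℝ) (n : ℕ) (s t : ℝ) : Measurable (kerF σ σ' n s t) := by
  unfold kerF
  refine Measurable.mul (((fullSeq_meas ..).sub (fullSeq_meas ..)).pow_const _) ?_
  exact Finset.measurable_fun_prod _ fun k _ =>
    ((fullSeq_meas ..).sub (fullSeq_meas ..)).pow_const _

lemma kerG_meas (σ σ' : ℝ) (n : ℕ) (s t : ℝ) : Measurable (kerG σ σ' n s t) :=
  (kerF_meas ..).ennreal_ofReal.indicator (stepSet_meas ..)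

lemma fullSeq_snoc (n : ℕ) (s t r : ℝ) (u : Fin n → ℝ) :
    fullSeq (n+1) s t (Fin.snoc u r : Fin (n+1) → ℝ) = Fin.snoc (fullSeq n s r u) t := by
  unfold fullSeq
  rw [Fin.cons_snoc_eq_snoc_cons]

lemma fullSeq_last (n : ℕ) (s t : ℝ) (u : Fin n → ℝ) : fullSeq n s t u (Fin.last _) = t := by
  simp [fullSeq]

lemma fullSeq_zero (n : ℕ) (s t : ℝ) (u : Fin n → ℝ) : fullSeq n s t u 0 = s := by
  unfold fullSeq
  rw [← Fin.castSucc_zero, Fin.snoc_castSucc]; rfl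

lemma stepSet_empty (n : ℕ) (s t : ℝ) (h : t < s) : stepSet n s t = ∅ := by
  ext u
  simp only [Set.mem_empty_iff_false, iff_false]
  intro hu
  have := (Fin.monotone_iff_le_succ.2 hu) (Fin.zero_le (Fin.last _))
  rw [fullSeq_last, fullSeq_zero] at this
  linarith

lemma mem_stepSet_snoc (n : ℕ) (s t r : ℝ) (u : Fin n → ℝ) :
    (Fin.snoc u r : Fin (n+1) → ℝ) ∈ stepSet (n+1) s t ↔ u ∈ stepSet n s r ∧ r ≤ t := by
  unfold stepSet
  simp only [Set.mem_ofPred_eq, fullSeq_snoc]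
  rw [Fin.forall_fin_succ']
  simp only [Fin.succ_castSucc, Fin.snoc_castSucc, Fin.succ_last, Fin.snoc_last, fullSeq_last]

lemma kerF_snoc (σ σ' : ℝ) (n : ℕ) (s t r : ℝ) (u : Fin n → ℝ) :
    kerF σ σ' (n+1) s t (Fin.snoc u r : Fin (n+1) → ℝ) = kerF σ σ' n s r u * (t - r) ^ (-σ) := by
  unfold kerF
  simp only [fullSeq_snoc]
  rw [Fin.prod_univ_castSucc]
  have h1 : (1 : Fin (n+1+2)) = (1 : Fin (n+2)).castSucc := by simp
  have h0 : (0 : Fin (n+1+2)) = (0 : Fin (n+2)).castSucc := by simp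
  rw [h1, h0]
  simp only [Fin.succ_castSucc, Fin.snoc_castSucc, Fin.succ_last, Fin.snoc_last, fullSeq_last]
  ring

lemma kerG_snoc (σ σ' : ℝ) (n : ℕ) (s t r : ℝ) (u : Fin n → ℝ) :
    kerG σ σ' (n+1) s t (Fin.snoc u r : Fin (n+1) → ℝ) =
      (Set.Iic t).indicator (fun r => ENNReal.ofReal ((t - r) ^ (-σ))) r * kerG σ σ' n s r u := by
  unfold kerG
  by_cases h1 : u ∈ stepSet n s r <;> by_cases h2 : r ≤ t
  · rw [Set.indicator_of_mem ((mem_stepSet_snoc ..).2 ⟨h1, h2⟩), Set.indicator_of_mem h1,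
      Set.indicator_of_mem (show r ∈ Set.Iic t from h2), kerF_snoc, mul_comm, 
      ENNReal.ofReal_mul (Real.rpow_nonneg (by linarith) _)]
  all_goals simp [mem_stepSet_snoc, h1, h2]

lemma lint_succ (σ σ' : ℝ) (n : ℕ) (s t : ℝ) :
    ∫⁻ u, kerG σ σ' (n+1) s t u = ∫⁻ r, (Set.Iic t).indicator
      (fun r => ENNReal.ofReal ((t - r) ^ (-σ))) r * ∫⁻ u, kerG σ σ' n s r u := by
  have hp := (volume_preserving_piFinSuccAbove (fun _ : Fin (n + 1) => ℝ) (Fin.last n)).symm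
  rw [← hp.lintegral_comp (kerG_meas ..), Measure.volume_eq_prod, 
    lintegral_prod (fun a => kerG σ σ' (n + 1) s t
      ((MeasurableEquiv.piFinSuccAbove (fun _ : Fin (n+1) => ℝ) (Fin.last n)).symm a))
      ((kerG_meas ..).comp (MeasurableEquiv.measurable _)).aemeasurable]
  refine lintegral_congr fun r => ?_
  rw [← lintegral_const_mul _ (kerG_meas ..)]
  refine lintegral_congr fun u => ?_
  rw [← kerG_snoc]
  congr 1
  exact Fin.insertNth_last' r u

lemma lint_beta01 (a b : ℝ) (ha : 0 < a) (hb : 0 < b) :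
    ∫⁻ x in Set.Ioo (0:ℝ) 1, ENNReal.ofReal (x ^ (a-1) * (1-x) ^ (b-1)) =
      ENNReal.ofReal (Gamma a * Gamma b / Gamma (a+b)) := by
  have h := ProbabilityTheory.lintegral_betaPDF_eq_one ha hb
  rw [ProbabilityTheory.lintegral_betaPDF] at h
  have hB := ProbabilityTheory.beta_pos ha hb
  have : ∀ x : ℝ, ENNReal.ofReal (1 / ProbabilityTheory.beta a b * x ^ (a - 1) * (1 - x) ^ (b - 1))
    = ENNReal.ofReal (1 / ProbabilityTheory.beta a b) * ENNReal.ofReal (x ^ (a-1) * (1-x) ^ (b-1)) := by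
    intro x
    rw [mul_assoc, ENNReal.ofReal_mul (by positivity)]
  simp only [this] at h
  rw [lintegral_const_mul _ (by fun_prop)] at h
  have h2 := congrArg (fun z => ENNReal.ofReal (ProbabilityTheory.beta a b) * z) h
  simp only [mul_one] at h2
  rw [← mul_assoc, ← ENNReal.ofReal_mul hB.le, mul_one_div_cancel hB.ne', ENNReal.ofReal_one, one_mul] at h2
  rw [h2]; rfl

lemma lint_beta (a b s t : ℝ) (ha : 0 < a) (hb : 0 < b) (h : s < t) :
    ∫⁻ x in Set.Ioo s t, ENNReal.ofReal ((x-s) ^ (a-1) * (t-x) ^ (b-1)) =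
      ENNReal.ofReal ((t-s) ^ (a+b-1) * (Gamma a * Gamma b / Gamma (a+b))) := by
  have hd : 0 < t - s := by linarith
  have him : (fun x => (t-s) * x + s) '' Set.Ioo (0:ℝ) 1 = Set.Ioo s t := by
    rw [Set.image_affine_Ioo hd]; simp
  rw [← him, lintegral_image_eq_lintegral_abs_deriv_mul (f' := fun _ => t - s) measurableSet_Ioo]
  · rw [ENNReal.ofReal_mul (by positivity), ← lint_beta01 a b ha hb,
      ← lintegral_const_mul _ (by fun_prop)]
    refine setLIntegral_congr_fun measurableSet_Ioo fun x hx => ?_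
    obtain ⟨hx0, hx1⟩ := hx
    have h1 : 0 < 1 - x := by linarith
    rw [abs_of_pos hd, ← ENNReal.ofReal_mul hd.le, ← ENNReal.ofReal_mul (by positivity)]
    congr 1
    rw [show (t-s)*x+s-s = (t-s)*x by ring, show t - ((t-s)*x+s) = (t-s)*(1-x) by ring,
      Real.mul_rpow hd.le hx0.le, Real.mul_rpow hd.le h1.le,
      show a+b-1 = 1 + (a-1) + (b-1) by ring, Real.rpow_add hd, Real.rpow_add hd, Real.rpow_one]
    ring
  · intro x _
    simpa using (((hasDerivAt_id x).const_mul (t-s)).add_const s).hasDerivWithinAt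
  · intro x _ y _ hxy
    simp only at hxy
    exact mul_left_cancel₀ hd.ne' (by linarith)

lemma lint_main (σ σ' : ℝ) (hσ : σ ∈ Set.Ioo (0:ℝ) 1) (hσ' : σ' ∈ Set.Ioo (0:ℝ) 1) (n : ℕ) (s : ℝ) :
    ∀ t, s < t → ∫⁻ u, kerG σ σ' n s t u = ENNReal.ofReal 
    ((t - s) ^ ((n:ℝ)*(1-σ) - σ') * Real.Gamma (1-σ) ^ n * Real.Gamma (1-σ') /
        Real.Gamma ((n:ℝ)*(1-σ) + (1-σ'))) := by
  have h1 : 0 < 1 - σ := by linarith [hσ.2]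
  have h1' : 0 < 1 - σ' := by linarith [hσ'.2]
  have g1 := Gamma_pos_of_pos h1
  have g1' := Gamma_pos_of_pos h1'
  induction n with
  | zero =>
    intro t ht
    rw [lintegral_unique]
    have hm : ∀ v : Fin 0 → ℝ, v ∈ stepSet 0 s t := by
      intro v i
      fin_cases i
      simpa [fullSeq, Fin.snoc] using ht.le
    unfold kerG
    rw [Set.indicator_of_mem (hm _)]
    have hv : (volume : Measure (Fin 0 → ℝ)) Set.univ = 1 := by
      rw [volume_pi, Measure.pi_of_empty (fun _ : Fin 0 => (volume : Measure ℝ)) isEmptyElim]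
      simp
    rw [hv]
    simp [kerF, fullSeq, Fin.snoc, g1'.ne']
  | succ n ih =>
    intro t ht
    rw [lint_succ]
    set a : ℝ := (n:ℝ)*(1-σ) + (1-σ') with ha
    have hap : 0 < a := by positivity
    have ga := Gamma_pos_of_pos hap
    set C : ℝ := Real.Gamma (1-σ) ^ n * Real.Gamma (1-σ') / Real.Gamma a with hC
    have hCp : 0 < C := by positivity
    have : ∀ᵐ r : ℝ, (Set.Iic t).indicator
      (fun r => ENNReal.ofReal ((t - r) ^ (-σ))) r * ∫⁻ u, kerG σ σ' n s r u =
      (Set.Ioo s t).indicator (fun r => ENNReal.ofReal C * 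
        ENNReal.ofReal ((r-s) ^ (a-1) * (t-r) ^ ((1-σ)-1))) r := by
      have e1 : ∀ᵐ r : ℝ, r ≠ s := by simp [ae_iff]
      have e2 : ∀ᵐ r : ℝ, r ≠ t := by simp [ae_iff]
      filter_upwards [e1, e2] with r hs ht'
      rcases lt_or_gt_of_ne hs with h | h
      · have : kerG σ σ' n s r = 0 := by unfold kerG; rw [stepSet_empty _ _ _ h]; exact Set.indicator_empty _
        rw [this, Set.indicator_of_notMem (s := Set.Ioo s t) (by simp [h.le])]
        simp
      rcases lt_or_gt_of_ne ht' with h' | h'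
      · have hd : 0 < t - r := by linarith
        have hd' : 0 < r - s := by linarith
        rw [Set.indicator_of_mem (show r ∈ Set.Iic t from h'.le), Set.indicator_of_mem (s := Set.Ioo s t) ⟨h, h'⟩,
          ih r h, ← ENNReal.ofReal_mul (by positivity), ← ENNReal.ofReal_mul hCp.le]
        congr 1
        rw [hC, show (n:ℝ)*(1-σ) - σ' = a - 1 by rw [ha]; ring, show 1 - σ - 1 = -σ by ring]
        ring
      · rw [Set.indicator_of_notMem (by simpa using h'), Set.indicator_of_notMem (by simp [h'.le])]
        simp
    rw [lintegral_congr_ae this, lintegral_indicator measurableSet_Ioo,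
      lintegral_const_mul _ (by fun_prop), lint_beta a (1-σ) s t hap h1 ht, ← ENNReal.ofReal_mul hCp.le]
    congr 1
    push_cast
    rw [show ((n:ℝ)+1)*(1-σ) - σ' = a + (1-σ) - 1 by rw [ha]; ring,
      show ((n:ℝ)+1)*(1-σ) + (1-σ') = a + (1-σ) by rw [ha]; ring, hC]
    have := Gamma_pos_of_pos (add_pos hap h1)
    field_simp
    ring

/-- Convolution of one copy of u ↦ u^{-σ'} 1_{u>0} with n copies of u ↦ u^{-σ} 1_{u>0}:
∫_{s ≤ t₁ ≤ ⋯ ≤ tₙ ≤ t} (t₁−s)^{-σ'} ∏_{k=1}^{n} (t_{k+1} − t_k)^{-σ} dt₁ ⋯ dtₙ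
  = (t−s)^{n(1−σ)−σ'} Γ(1−σ)ⁿ Γ(1−σ') / Γ(n(1−σ)+(1−σ')),  with t_{n+1} = t. -/
theorem iterated_kernel_convolution_mixed (σ σ' : ℝ)
    (hσ : σ ∈ Set.Ioo (0:ℝ) 1) (hσ' : σ' ∈ Set.Ioo (0:ℝ) 1)
    (n : ℕ) (hn : 1 ≤ n) (s t : ℝ) (hst : s < t) :
    (∫ u in {u : Fin n → ℝ | ∀ i : Fin (n+1),
        fullSeq n s t u i.castSucc ≤ fullSeq n s t u i.succ},
      (fullSeq n s t u 1 - fullSeq n s t u 0) ^ (-σ') *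
        ∏ k : Fin n, (fullSeq n s t u k.succ.succ - fullSeq n s t u k.succ.castSucc) ^ (-σ))
    = (t - s) ^ ((n:ℝ)*(1-σ) - σ') * Real.Gamma (1-σ) ^ n * Real.Gamma (1-σ') /
        Real.Gamma ((n:ℝ)*(1-σ) + (1-σ')) := by
  have hm := lint_main σ σ' hσ hσ' n s t hst
  have h1 : 0 < 1 - σ := by linarith [hσ.2]
  have h1' : 0 < 1 - σ' := by linarith [hσ'.2]
  have hd : 0 < t - s := by linarith
  have g1 := Gamma_pos_of_pos h1
  have g1' := Gamma_pos_of_pos h1'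
  have g2 : 0 < Gamma ((n:ℝ)*(1-σ) + (1-σ')) := Gamma_pos_of_pos (by positivity)
  change ∫ u in stepSet n s t, kerF σ σ' n s t u = _
  rw [integral_eq_lintegral_of_nonneg_ae, ← lintegral_indicator (stepSet_meas ..)]
  · change (∫⁻ u, kerG σ σ' n s t u).toReal = _
    rw [hm, ENNReal.toReal_ofReal (by positivity)]
  · refine (ae_restrict_iff' (stepSet_meas ..)).2 (Filter.Eventually.of_forall fun u hu => ?_)
    refine mul_nonneg (Real.rpow_nonneg (sub_nonneg.2 (hu 0)) _) (Finset.prod_nonneg fun k _ => ?_)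
    exact Real.rpow_nonneg (sub_nonneg.2 (hu k.succ)) _
  · exact (kerF_meas ..).aestronglyMeasurable
end

section
/- Let λ > 1. There exists a constant C < ∞, depending only on λ, such that the following holds. Let τ > 0, 𝔠 > 0, and let F : [0,τ) → [0,∞) be a continuous function such that for all 0 ≤ s < t < τ one has ∫ₛᵗ F(r)^λ dr ≤ 𝔠 · F(s). Then there exist an integer N ≥ 1 and a finite increasing sequence 0 = t₀ < t₁ < t₂ < ⋯ < t_N = τ such that for every n ∈ {0, …, N−1}, F(tₙ) ≤ C · 𝔠^{1/(λ−1)} · t_{n+1}^{-1/(λ−1)}. -/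
open MeasureTheory Real

lemma ode_step (lam τ c B : ℝ) (F : ℝ → ℝ) (hlam : 1 < lam) (hc : 0 < c)
    (hB : B = 2 * 2 ^ lam)
    (hF : ContinuousOn F (Set.Ico 0 τ))
    (hI : ∀ s t : ℝ, 0 ≤ s → s < t → t < τ → (∫ r in s..t, F r ^ lam) ≤ c * F s)
    (s : ℝ) (hs : 0 ≤ s) (hpos : 0 < F s) (hst : s + B * c / F s ^ (lam - 1) < τ) :
    ∃ t, s < t ∧ t ≤ s + B * c / F s ^ (lam - 1) ∧ F t ≤ F s / 2 := by
  by_contra! hcon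
  have hBpos : 0 < B := by rw [hB]; positivity
  have hP : 0 < F s ^ (lam - 1) := by positivity
  set h := B * c / F s ^ (lam - 1) with hh
  have hhpos : 0 < h := by positivity
  have h1 := hI s (s + h) hs (by linarith) hst
  have hge : ∀ r ∈ Set.Icc s (s + h), F s / 2 ≤ F r := by
    intro r hr
    rcases eq_or_lt_of_le hr.1 with e | e
    · rw [← e]; linarith
    · exact (hcon r e hr.2).le
  have hint : IntervalIntegrable (fun r => F r ^ lam) volume s (s + h) := by
    apply ContinuousOn.intervalIntegrable
    rw [Set.uIcc_of_le (by linarith)]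
    apply ContinuousOn.rpow_const
    · exact hF.mono (fun r hr => ⟨hs.trans hr.1, hr.2.trans_lt hst⟩)
    · intro r hr; right; linarith
  have h2 : (∫ r in s..(s + h), (F s / 2) ^ lam) ≤ ∫ r in s..(s + h), F r ^ lam := by
    apply intervalIntegral.integral_mono_on (by linarith) (by simp) hint
    intro r hr
    exact Real.rpow_le_rpow (by positivity) (hge r hr) (by linarith)
  rw [intervalIntegral.integral_const, smul_eq_mul, Real.div_rpow hpos.le (by norm_num)] at h2
  have h3 : F s ^ lam = F s ^ (lam - 1) * F s := by
    rw [Real.rpow_sub_one hpos.ne']; field_simp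
  have h4 : (s + h - s) * (F s ^ lam / 2 ^ lam) = 2 * (c * F s) := by
    have : (0:ℝ) < 2 ^ lam := by positivity
    rw [h3, add_sub_cancel_left, hh, hB]; field_simp
  have : 0 < c * F s := by positivity
  linarith

lemma ode_bound (lam c D f t : ℝ) (hlam : 1 < lam) (hc : 0 < c) (hD : 0 < D) (hf : 0 ≤ f)
    (ht : 0 < t) (h : t * f ^ (lam - 1) ≤ D * c) :
    f ≤ D ^ ((1:ℝ)/(lam-1)) * c ^ ((1:ℝ)/(lam-1)) * t ^ (-((1:ℝ)/(lam-1))) := by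
  have hl : 0 < lam - 1 := by linarith
  rw [Real.rpow_neg ht.le, ← Real.mul_rpow hD.le hc.le, ← div_eq_mul_inv,
    ← Real.div_rpow (by positivity) ht.le]
  have h2 : f ^ (lam - 1) ≤ D * c / t := by rw [le_div_iff₀ ht]; linarith
  calc f = (f ^ (lam - 1)) ^ (1 / (lam - 1)) := by
        rw [← Real.rpow_mul hf, mul_one_div_cancel hl.ne', Real.rpow_one]
    _ ≤ _ := Real.rpow_le_rpow (by positivity) h2 (by positivity)

lemma ode_iter (lam τ c A B q : ℝ) (F : ℝ → ℝ) (hlam : 1 < lam) (hτ : 0 < τ) (hc : 0 < c)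
    (hB : B = 2 * 2 ^ lam) (hq : q = 2 ^ (lam - 1)) (hA : 0 < A) (hAB : A + B = A * q)
    (hF : ContinuousOn F (Set.Ico 0 τ))
    (h0 : ∀ t ∈ Set.Ico (0:ℝ) τ, 0 ≤ F t)
    (hI : ∀ s t : ℝ, 0 ≤ s → s < t → t < τ → (∫ r in s..t, F r ^ lam) ≤ c * F s) (n : ℕ) :
    ∀ s ∈ Set.Ico (0:ℝ) τ, s * F s ^ (lam - 1) ≤ A * c →
      F s ^ (lam - 1) * τ ≤ q ^ n * ((A + B) * c) →
      ∃ N : ℕ, 1 ≤ N ∧ ∃ tt : ℕ → ℝ, tt 0 = s ∧ tt N = τ ∧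
        (∀ n < N, tt n < tt (n+1)) ∧
        ∀ n < N, F (tt n) ≤ (A + B) ^ ((1:ℝ)/(lam-1)) * c ^ ((1:ℝ)/(lam-1)) *
          (tt (n+1)) ^ (-((1:ℝ)/(lam-1))) := by
  have hBpos : 0 < B := by rw [hB]; positivity
  have hqpos : 0 < q := by rw [hq]; positivity
  have hl : 0 < lam - 1 := by linarith
  have base : ∀ s ∈ Set.Ico (0:ℝ) τ, τ * F s ^ (lam - 1) ≤ (A + B) * c →
      ∃ N : ℕ, 1 ≤ N ∧ ∃ tt : ℕ → ℝ, tt 0 = s ∧ tt N = τ ∧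
        (∀ n < N, tt n < tt (n+1)) ∧
        ∀ n < N, F (tt n) ≤ (A + B) ^ ((1:ℝ)/(lam-1)) * c ^ ((1:ℝ)/(lam-1)) *
          (tt (n+1)) ^ (-((1:ℝ)/(lam-1))) := by
    intro s hs h
    refine ⟨1, le_rfl, fun n => if n = 0 then s else τ, by simp, by simp, ?_, ?_⟩
    · intro n hn
      obtain rfl : n = 0 := by omega
      simpa using hs.2
    · intro n hn
      obtain rfl : n = 0 := by omega
      simpa using ode_bound lam c (A + B) (F s) τ hlam hc (by positivity) (h0 s hs) hτ h
  induction n with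
  | zero =>
    intro s hs _ h
    exact base s hs (by simpa [mul_comm] using h)
  | succ n ih =>
    intro s hs h1 h2
    by_cases hb : τ * F s ^ (lam - 1) ≤ (A + B) * c
    · exact base s hs hb
    push Not at hb
    have hpos : 0 < F s := by
      rcases eq_or_lt_of_le (h0 s hs) with e | e
      · rw [← e, Real.zero_rpow hl.ne'] at hb
        have : 0 < (A + B) * c := by positivity
        linarith
      · exact e
    have hP : 0 < F s ^ (lam - 1) := by positivity
    have hmul : (s + B * c / F s ^ (lam - 1)) * F s ^ (lam - 1) ≤ (A + B) * c := by
      rw [add_mul, div_mul_cancel₀ _ hP.ne']; linarith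
    have hst : s + B * c / F s ^ (lam - 1) < τ :=
      lt_of_mul_lt_mul_right (hmul.trans_lt hb) hP.le
    obtain ⟨t, hst1, ht2, hFt⟩ := ode_step lam τ c B F hlam hc hB hF hI s hs.1 hpos hst
    have ht : t ∈ Set.Ico (0:ℝ) τ := ⟨hs.1.trans hst1.le, ht2.trans_lt hst⟩
    have htpos : 0 < t := hs.1.trans_lt hst1
    have htF : t * F s ^ (lam - 1) ≤ (A + B) * c :=
      (mul_le_mul_of_nonneg_right ht2 hP.le).trans hmul
    have hdec : F t ^ (lam - 1) ≤ F s ^ (lam - 1) / q := by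
      rw [hq, ← Real.div_rpow hpos.le (by norm_num)]
      exact Real.rpow_le_rpow (h0 t ht) hFt hl.le
    obtain ⟨N, hN, tt, e0, eN, hinc, hbd⟩ := ih t ht (by
      calc t * F t ^ (lam - 1) ≤ t * (F s ^ (lam - 1) / q) := by gcongr
        _ = t * F s ^ (lam - 1) / q := by ring
        _ ≤ (A + B) * c / q := by gcongr
        _ = A * c := by rw [hAB]; field_simp) (by
      calc F t ^ (lam - 1) * τ ≤ F s ^ (lam - 1) / q * τ := by gcongr
        _ = F s ^ (lam - 1) * τ / q := by ring
        _ ≤ q ^ (n + 1) * ((A + B) * c) / q := by gcongr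
        _ = q ^ n * ((A + B) * c) := by rw [pow_succ]; field_simp)
    refine ⟨N + 1, by omega, fun k => Nat.casesOn k s tt, rfl, eN, ?_, ?_⟩
    · intro k hk
      cases k with
      | zero => simpa [e0] using hst1
      | succ k => exact hinc k (by omega)
    · intro k hk
      cases k with
      | zero =>
        simpa [e0] using ode_bound lam c (A + B) (F s) t hlam hc (by positivity) hpos.le htpos htF
      | succ k => exact hbd k (by omega)


/-- The abstract ODE-type iteration lemma (Lemma 8.3 of the paper): if F ≥ 0 is
continuous on [0,τ) and ∫ₛᵗ F^λ ≤ 𝔠 F(s) for all 0 ≤ s < t < τ, then there is a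
finite increasing sequence 0 = t₀ < ⋯ < t_N = τ along which
F(tₙ) ≲ 𝔠^{1/(λ−1)} t_{n+1}^{-1/(λ−1)}. -/
theorem ode_iteration_lemma (lam : ℝ) (hlam : 1 < lam) :
    ∃ C : ℝ, ∀ (τ 𝔠 : ℝ) (F : ℝ → ℝ), 0 < τ → 0 < 𝔠 →
      ContinuousOn F (Set.Ico 0 τ) →
      (∀ t ∈ Set.Ico (0:ℝ) τ, 0 ≤ F t) →
      (∀ s t : ℝ, 0 ≤ s → s < t → t < τ → (∫ r in s..t, F r ^ lam) ≤ 𝔠 * F s) →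
      ∃ N : ℕ, 1 ≤ N ∧ ∃ tt : ℕ → ℝ, tt 0 = 0 ∧ tt N = τ ∧
        (∀ n < N, tt n < tt (n+1)) ∧
        ∀ n < N, F (tt n) ≤ C * 𝔠 ^ ((1:ℝ)/(lam-1)) * (tt (n+1)) ^ (-((1:ℝ)/(lam-1))) := by
  have hl : 0 < lam - 1 := by linarith
  have hq1 : (1:ℝ) < 2 ^ (lam - 1) := Real.one_lt_rpow (by norm_num) hl
  obtain ⟨q, hq⟩ : ∃ q : ℝ, q = 2 ^ (lam - 1) := ⟨_, rfl⟩
  obtain ⟨B, hB⟩ : ∃ B : ℝ, B = 2 * 2 ^ lam := ⟨_, rfl⟩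
  rw [← hq] at hq1
  have hq0 : 0 < q - 1 := by linarith
  have hBpos : 0 < B := by rw [hB]; positivity
  have hA : 0 < B / (q - 1) := by positivity
  have hAB : B / (q - 1) + B = B / (q - 1) * q := by
    field_simp
    ring
  refine ⟨(B / (q - 1) + B) ^ ((1:ℝ)/(lam-1)), ?_⟩
  intro τ c F hτ hc hF h0 hI
  have hD : 0 < (B / (q - 1) + B) * c := by positivity
  obtain ⟨n, hn⟩ := pow_unbounded_of_one_lt
    (F 0 ^ (lam - 1) * τ / ((B / (q - 1) + B) * c)) hq1
  refine ode_iter lam τ c (B / (q - 1)) B q F hlam hτ hc hB hq hA hAB hF h0 hI n 0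
    ⟨le_rfl, hτ⟩ ?_ ?_
  · rw [zero_mul]; positivity
  · exact ((div_lt_iff₀ hD).1 hn).le
end

section
/- Let λ > 1, τ > 0, 𝔠 > 0, and let F : [0,τ) → [0,∞) be a continuous function such that for all 0 ≤ s < t < τ one has ∫ₛᵗ F(r)^λ dr ≤ 𝔠 · F(s). If F(0) > 0 and 𝔠 · 2^λ · F(0)^{1−λ} < τ, then there exists t₁ ∈ (0, 𝔠 · 2^λ · F(0)^{1−λ}] such that F(t₁) ≤ F(0)/2. -/
open MeasureTheory Real

/-- Single-step halving claim from the induction in the proof of the iteration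
lemma (Lemma 8.3 of the paper): if F(0) > 0 and 𝔠 2^λ F(0)^{1−λ} < τ, then F drops
below F(0)/2 at some time t₁ ∈ (0, 𝔠 2^λ F(0)^{1−λ}]. -/
theorem ode_iteration_single_step (lam τ 𝔠 : ℝ) (hlam : 1 < lam) (hτ : 0 < τ)
    (h𝔠 : 0 < 𝔠) (F : ℝ → ℝ)
    (hFcont : ContinuousOn F (Set.Ico 0 τ))
    (hFnonneg : ∀ t ∈ Set.Ico (0:ℝ) τ, 0 ≤ F t)
    (hint : ∀ s t : ℝ, 0 ≤ s → s < t → t < τ → (∫ r in s..t, F r ^ lam) ≤ 𝔠 * F s)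
    (hF0 : 0 < F 0)
    (hsmall : 𝔠 * 2 ^ lam * F 0 ^ (1 - lam) < τ) :
    ∃ t₁ : ℝ, 0 < t₁ ∧ t₁ ≤ 𝔠 * 2 ^ lam * F 0 ^ (1 - lam) ∧ F t₁ ≤ F 0 / 2 := by
  by_contra! hcon
  set T := 𝔠 * 2 ^ lam * F 0 ^ (1 - lam) with hT
  have hTpos : 0 < T := by positivity
  have hcont : ContinuousOn (fun r => F r ^ lam) (Set.Icc 0 T) := by
    apply ContinuousOn.rpow_const
    · exact hFcont.mono fun x hx => ⟨hx.1, lt_of_le_of_lt hx.2 hsmall⟩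
    · intro x _
      right
      linarith
  have hlt : ∀ x, 0 < x → x ≤ T → (F 0 / 2) ^ lam < F x ^ lam := fun x h1 h2 =>
    Real.rpow_lt_rpow (by positivity) (hcon x h1 h2) (by linarith)
  have h1 : (∫ _ in (0:ℝ)..T, (F 0 / 2) ^ lam) < ∫ r in (0:ℝ)..T, F r ^ lam :=
    intervalIntegral.integral_lt_integral_of_continuousOn_of_le_of_exists_lt hTpos
      continuousOn_const hcont (fun x hx => (hlt x hx.1 hx.2).le)
      ⟨T, ⟨hTpos.le, le_rfl⟩, hlt T hTpos le_rfl⟩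
  have h2 := hint 0 T le_rfl hTpos hsmall
  have h3 : T * (F 0 / 2) ^ lam = 𝔠 * F 0 := by
    rw [hT, Real.div_rpow hF0.le (by norm_num), Real.rpow_sub hF0, Real.rpow_one]
    have : (0:ℝ) < 2 ^ lam := by positivity
    have : 0 < F 0 ^ lam := by positivity
    field_simp
  rw [intervalIntegral.integral_const, smul_eq_mul, sub_zero, h3] at h1
  linarith
end

section
/- Let d ≥ 1 be an integer, let p, p₁, p₂ ∈ [1,∞) satisfy 1/p = 1/p₁ + 1/p₂, and let s ∈ ℝ. Let G, F, g : ℝ^d → ℝ be measurable functions. Define h : ℝ^d → [0,∞] by h(x) = ∫_{ℝ^d} |G(y)| · |g(x−y)| · |F(x−s·y)| dy. Then ‖h‖_{L^p(ℝ^d)} ≤ ‖G‖_{L¹(ℝ^d)} · ‖F‖_{L^{p₁}(ℝ^d)} · ‖g‖_{L^{p₂}(ℝ^d)}. -/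
open MeasureTheory ENNReal

/-- Generalized Young–Hölder inequality (from the proof of Proposition A.12 of
the paper): for 1/p = 1/p₁ + 1/p₂ and h(x) = ∫ |G(y)| |g(x−y)| |F(x−s·y)| dy one
has ‖h‖_{L^p} ≤ ‖G‖_{L¹} ‖F‖_{L^{p₁}} ‖g‖_{L^{p₂}}, with constant 1. -/
theorem generalized_young_holder (d : ℕ) (hd : 1 ≤ d) (p p₁ p₂ : ℝ)
    (hp : 1 ≤ p) (hp₁ : 1 ≤ p₁) (hp₂ : 1 ≤ p₂)
    (hpp : 1/p = 1/p₁ + 1/p₂) (s : ℝ)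
    (G F g : (Fin d → ℝ) → ℝ)
    (hG : Measurable G) (hF : Measurable F) (hg : Measurable g)
    (h : (Fin d → ℝ) → ℝ≥0∞)
    (hh : ∀ x, h x = ∫⁻ y, ENNReal.ofReal |G y| * ENNReal.ofReal |g (x - y)| *
      ENNReal.ofReal |F (x - s • y)|) :
    (∫⁻ x, h x ^ p) ^ (1/p) ≤
      (∫⁻ y, ENNReal.ofReal |G y|) *
        ((∫⁻ x, ENNReal.ofReal |F x| ^ p₁) ^ (1/p₁) *
          (∫⁻ x, ENNReal.ofReal |g x| ^ p₂) ^ (1/p₂)) := by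
  have hp0 : 0 < p := by linarith
  have hp10 : 0 < p₁ := by linarith
  have hp20 : 0 < p₂ := by linarith
  have hlt : p < p₁ := by
    have : 0 < 1 / p₂ := by positivity
    exact (one_div_lt_one_div hp10 hp0).1 (by linarith)
  have hinv : 1 / p ≤ 1 := by
    rw [div_le_one hp0]; exact hp
  set a : (Fin d → ℝ) → ℝ≥0∞ := fun y => ENNReal.ofReal |G y| with ha
  set b : (Fin d → ℝ) → ℝ≥0∞ := fun y => ENNReal.ofReal |F y| with hb
  set c : (Fin d → ℝ) → ℝ≥0∞ := fun y => ENNReal.ofReal |g y| with hc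
  have ham : Measurable a := by fun_prop
  have hbm : Measurable b := by fun_prop
  have hcm : Measurable c := by fun_prop
  change _ ≤ (∫⁻ y, a y) * ((∫⁻ x, b x ^ p₁) ^ (1/p₁) * (∫⁻ x, c x ^ p₂) ^ (1/p₂))
  set A := ∫⁻ y, a y with hA
  set K := (∫⁻ x, b x ^ p₁) ^ (1/p₁) * (∫⁻ x, c x ^ p₂) ^ (1/p₂) with hK
  have h1 : ∀ x, h x ^ p ≤ A ^ (p - 1) * ∫⁻ y, a y * (b (x - s • y) * c (x - y)) ^ p := by
    intro x
    have e : h x = ∫⁻ y, a y ^ (1 - 1/p) * (a y * (b (x - s • y) * c (x - y)) ^ p) ^ (1/p) := by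
      rw [hh]
      refine lintegral_congr fun y => ?_
      change a y * c (x - y) * b (x - s • y) = _
      rw [ENNReal.mul_rpow_of_nonneg _ _ (by positivity), ← ENNReal.rpow_mul,
        mul_one_div_cancel hp0.ne', ENNReal.rpow_one, ← mul_assoc,
        ← ENNReal.rpow_add_of_nonneg _ _ (by linarith) (by positivity), sub_add_cancel,
        ENNReal.rpow_one]
      ring
    have h2 : h x ≤ A ^ (1 - 1/p) * (∫⁻ y, a y * (b (x - s • y) * c (x - y)) ^ p) ^ (1/p) := by
      rw [e]
      exact ENNReal.lintegral_mul_norm_pow_le (by fun_prop) (by fun_prop) (by linarith)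
        (by positivity) (by ring)
    calc h x ^ p ≤ _ := ENNReal.rpow_le_rpow h2 hp0.le
      _ = _ := by
        rw [ENNReal.mul_rpow_of_nonneg _ _ hp0.le, ← ENNReal.rpow_mul, ← ENNReal.rpow_mul,
          one_div_mul_cancel hp0.ne', ENNReal.rpow_one]
        congr 2
        field_simp
  have h3 : ∀ y, ∫⁻ x, (b (x - s • y) * c (x - y)) ^ p ≤ K ^ p := by
    intro y
    have := ENNReal.lintegral_Lp_mul_le_Lq_mul_Lr hp0 hlt hpp volume
      (f := fun x => b (x - s • y)) (g := fun x => c (x - y)) (by fun_prop) (by fun_prop)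
    rw [lintegral_sub_right_eq_self (fun x => b x ^ p₁) (s • y),
      lintegral_sub_right_eq_self (fun x => c x ^ p₂) y] at this
    have := ENNReal.rpow_le_rpow this hp0.le
    rwa [← ENNReal.rpow_mul, one_div_mul_cancel hp0.ne', ENNReal.rpow_one] at this
  have h4 : ∫⁻ x, h x ^ p ≤ (A * K) ^ p := by
    calc ∫⁻ x, h x ^ p
        ≤ ∫⁻ x, A ^ (p - 1) * ∫⁻ y, a y * (b (x - s • y) * c (x - y)) ^ p :=
          lintegral_mono h1
      _ = A ^ (p - 1) * ∫⁻ x, ∫⁻ y, a y * (b (x - s • y) * c (x - y)) ^ p := by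
          rw [lintegral_const_mul]
          refine Measurable.lintegral_prod_right' (f := fun z : (Fin d → ℝ) × (Fin d → ℝ) =>
            a z.2 * (b (z.1 - s • z.2) * c (z.1 - z.2)) ^ p) ?_
          fun_prop
      _ = A ^ (p - 1) * ∫⁻ y, ∫⁻ x, a y * (b (x - s • y) * c (x - y)) ^ p := by
          rw [lintegral_lintegral_swap]
          refine Measurable.aemeasurable ?_
          unfold Function.uncurry
          fun_prop
      _ ≤ A ^ (p - 1) * ∫⁻ y, a y * K ^ p := by
          gcongr with y
          rw [lintegral_const_mul _ (by fun_prop)]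
          gcongr
          exact h3 y
      _ = (A * K) ^ p := by
          rw [lintegral_mul_const _ ham, ENNReal.mul_rpow_of_nonneg A K hp0.le, ← mul_assoc]
          congr 1
          change A ^ (p - 1) * A = _
          nth_rewrite 2 [← ENNReal.rpow_one A]
          rw [← ENNReal.rpow_add_of_nonneg _ _ (by linarith) (by norm_num), sub_add_cancel]
  have := ENNReal.rpow_le_rpow h4 (by positivity : 0 ≤ 1 / p)
  rwa [← ENNReal.rpow_mul, mul_one_div_cancel hp0.ne', ENNReal.rpow_one] at this
end

section
/- Let (X, 𝒜, μ) be a finite measure space, let T > 0, let α > 1/2, let m ≥ 2 be an integer, and let w : [0,T] → (X → ℝ) be a function such that: (i) for every t ∈ [0,T], w(t) is bounded and measurable, and sup_{t ∈ [0,T]} ‖w(t)‖_{L^∞(μ)} < ∞; (ii) w is α-Hölder continuous in the sup norm, i.e. there is L < ∞ with ‖w(t) − w(s)‖_{L^∞(μ)} ≤ L |t−s|^α for all s, t ∈ [0,T]. Then for every sequence of partitions 0 = t₀^{(k)} < t₁^{(k)} < ⋯ < t_{n_k}^{(k)} = T of [0,T] whose mesh max_i (t_{i+1}^{(k)} − t_i^{(k)})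 tends to 0 as k → ∞, one has Σ_{i=0}^{n_k − 1} ∫_X ( w(t_{i+1}^{(k)}) − w(t_i^{(k)}) ) · w(t_i^{(k)})^{m−1} dμ → (1/m) ∫_X ( w(T)^m − w(0)^m ) dμ as k → ∞. -/
open MeasureTheory Filter


theorem taylor_aux (M : ℝ) (hM : 0 ≤ M) (m : ℕ) : ∃ C : ℝ, 0 ≤ C ∧ ∀ a b : ℝ, |a| ≤ M → |b| ≤ M →
    |b^(m+1) - a^(m+1) - (m+1)*((b-a)*a^m)| ≤ C * (b-a)^2 := by
  induction m with
  | zero => exact ⟨0, le_rfl, fun a b _ _ => by simp⟩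
  | succ m ih =>
    obtain ⟨C, hC, h⟩ := ih
    refine ⟨M * C + (m+1) * M^m, by positivity, fun a b ha hb => ?_⟩
    have e : b^(m+1+1) - a^(m+1+1) - ((m+1:ℕ)+1)*((b-a)*a^(m+1))
        = b * (b^(m+1) - a^(m+1) - (m+1)*((b-a)*a^m)) + (m+1) * a^m * (b-a)^2 := by
      push_cast; ring
    rw [e]
    refine (abs_add_le _ _).trans ?_
    rw [abs_mul, abs_mul, abs_mul, abs_pow, abs_of_nonneg (sq_nonneg (b-a)),
      abs_of_nonneg (by positivity : (0:ℝ) ≤ m+1), add_mul (M * C), mul_assoc M]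
    have h1 := h a b ha hb
    gcongr

theorem ae_of_top {X : Type*} [MeasurableSpace X] (μ : Measure X) (f : X → ℝ) (c : ℝ) (hc : 0 ≤ c)
    (h : eLpNorm f ⊤ μ ≤ ENNReal.ofReal c) : ∀ᵐ x ∂μ, |f x| ≤ c := by
  rw [eLpNorm_exponent_top] at h
  filter_upwards [enorm_ae_le_eLpNormEssSup f μ] with x hx
  have := hx.trans h
  rw [← ofReal_norm, ENNReal.ofReal_le_ofReal_iff hc] at this
  simpa using this

/-- Riemann-sum/chain-rule convergence claim from the proof of the testing
identity (Proposition 6.2 of the paper): for w bounded, measurable in space and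
α-Hölder continuous in time (α > 1/2) with values in L^∞(μ), μ a finite measure,
the telescoping Riemann sums ∑ᵢ ∫ (w(t_{i+1}) − w(tᵢ)) w(tᵢ)^{m−1} dμ converge to
(1/m) ∫ (w(T)^m − w(0)^m) dμ as the mesh of the partitions tends to zero. -/
theorem riemann_sum_chain_rule {X : Type*} [MeasurableSpace X]
    (μ : Measure X) [IsFiniteMeasure μ]
    (T : ℝ) (hT : 0 < T) (α : ℝ) (hα : 1/2 < α) (m : ℕ) (hm : 2 ≤ m)
    (w : ℝ → X → ℝ)
    (hmeas : ∀ t ∈ Set.Icc (0:ℝ) T, Measurable (w t))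
    (hbdd : ∃ M : ℝ, ∀ t ∈ Set.Icc (0:ℝ) T, eLpNorm (w t) ⊤ μ ≤ ENNReal.ofReal M)
    (hHolder : ∃ L : ℝ, ∀ s ∈ Set.Icc (0:ℝ) T, ∀ t ∈ Set.Icc (0:ℝ) T,
      eLpNorm (fun x => w t x - w s x) ⊤ μ ≤ ENNReal.ofReal (L * |t - s| ^ α))
    (tt : ℕ → ℕ → ℝ) (n : ℕ → ℕ)
    (hpart0 : ∀ k, tt k 0 = 0) (hpartT : ∀ k, tt k (n k) = T)
    (hmono : ∀ k, ∀ i < n k, tt k i < tt k (i+1))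
    (hmesh : ∀ ε : ℝ, 0 < ε → ∃ K : ℕ, ∀ k ≥ K, ∀ i < n k, tt k (i+1) - tt k i ≤ ε) :
    Tendsto (fun k => ∑ i ∈ Finset.range (n k),
        ∫ x, (w (tt k (i+1)) x - w (tt k i) x) * (w (tt k i) x) ^ (m-1) ∂μ)
      atTop
      (nhds ((1/(m:ℝ)) * ∫ x, ((w T x) ^ m - (w 0 x) ^ m) ∂μ)) := by
  obtain ⟨M0, hM0⟩ := hbdd
  obtain ⟨L0, hL0⟩ := hHolder
  obtain ⟨M, hM, hwM⟩ : ∃ M : ℝ, 0 ≤ M ∧ ∀ t ∈ Set.Icc (0:ℝ) T, ∀ᵐ x ∂μ, |w t x| ≤ M :=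
    ⟨max M0 0, le_max_right _ _, fun t ht => ae_of_top μ _ _ (le_max_right _ _)
      ((hM0 t ht).trans (ENNReal.ofReal_le_ofReal (le_max_left _ _)))⟩
  obtain ⟨L, hL, hwL⟩ : ∃ L : ℝ, 0 ≤ L ∧ ∀ s ∈ Set.Icc (0:ℝ) T, ∀ t ∈ Set.Icc (0:ℝ) T,
      ∀ᵐ x ∂μ, |w t x - w s x| ≤ L * |t - s| ^ α :=
    ⟨max L0 0, le_max_right _ _, fun s hs t ht => ae_of_top μ _ _ (by positivity)
      ((hL0 s hs t ht).trans (ENNReal.ofReal_le_ofReal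
        (mul_le_mul_of_nonneg_right (le_max_left _ _) (by positivity))))⟩
  obtain ⟨p, rfl⟩ : ∃ p, m = p + 1 := ⟨m - 1, by omega⟩
  obtain ⟨C, hC, hT2⟩ := taylor_aux M hM p
  simp only [Nat.add_sub_cancel]
  have hmem : ∀ k, ∀ i ≤ n k, tt k i ∈ Set.Icc (0:ℝ) T := by
    intro k
    have h0 : ∀ i ≤ n k, 0 ≤ tt k i := by
      intro i
      induction i with
      | zero => intro _; rw [hpart0]
      | succ i ih => intro hi; exact (ih (by omega)).trans (hmono k i (by omega)).le
    have h1 : ∀ j ≤ n k, tt k (n k - j) ≤ T := by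
      intro j
      induction j with
      | zero => intro _; simp [hpartT]
      | succ j ih =>
        intro hj
        have := hmono k (n k - (j+1)) (by omega)
        rw [show n k - (j+1) + 1 = n k - j by omega] at this
        exact this.le.trans (ih (by omega))
    intro i hi
    refine ⟨h0 i hi, ?_⟩
    have := h1 (n k - i) (by omega)
    rwa [show n k - (n k - i) = i by omega] at this
  have hintp : ∀ t ∈ Set.Icc (0:ℝ) T, ∀ q : ℕ, Integrable (fun x => w t x ^ q) μ := by
    intro t ht q
    refine Integrable.of_bound ((hmeas t ht).pow_const q).aestronglyMeasurable (M^q) ?_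
    filter_upwards [hwM t ht] with x hx
    rw [norm_pow, Real.norm_eq_abs]
    gcongr
  have hintm : ∀ s ∈ Set.Icc (0:ℝ) T, ∀ t ∈ Set.Icc (0:ℝ) T,
      Integrable (fun x => (w t x - w s x) * w s x ^ p) μ := by
    intro s hs t ht
    refine Integrable.of_bound (((hmeas t ht).sub (hmeas s hs)).mul
      ((hmeas s hs).pow_const p)).aestronglyMeasurable ((M+M)*M^p) ?_
    filter_upwards [hwM t ht, hwM s hs] with x hx hx'
    rw [norm_mul, norm_pow, Real.norm_eq_abs, Real.norm_eq_abs]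
    have := (abs_sub (w t x) (w s x)).trans (add_le_add hx hx')
    gcongr
  -- one-step estimate
  have hstep : ∀ s ∈ Set.Icc (0:ℝ) T, ∀ t ∈ Set.Icc (0:ℝ) T,
      |(∫ x, w t x ^ (p+1) ∂μ) - (∫ x, w s x ^ (p+1) ∂μ)
        - (p+1) * ∫ x, (w t x - w s x) * w s x ^ p ∂μ|
      ≤ C * (L * |t - s| ^ α)^2 * μ.real Set.univ := by
    intro s hs t ht
    have hsub : Integrable (fun x => w t x ^ (p+1) - w s x ^ (p+1)) μ :=
      (hintp t ht _).sub (hintp s hs _)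
    rw [← integral_const_mul, ← integral_sub (hintp t ht _) (hintp s hs _),
      ← integral_sub hsub ((hintm s hs t ht).const_mul _),
      ← Real.norm_eq_abs]
    refine norm_integral_le_of_norm_le_const ?_
    filter_upwards [hwM t ht, hwM s hs, hwL s hs t ht] with x h1 h2 h3
    refine (hT2 _ _ h2 h1).trans ?_
    rw [← sq_abs (w t x - w s x)]
    gcongr
  set D : ℝ := C * L^2 * μ.real Set.univ with hD
  have hD0 : 0 ≤ D := by positivity
  have hβ : 0 < 2 * α - 1 := by linarith
  -- total estimate
  have htot : ∀ k, ∀ δ : ℝ, (∀ i < n k, tt k (i+1) - tt k i ≤ δ) →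
      |(∑ i ∈ Finset.range (n k), ∫ x, (w (tt k (i+1)) x - w (tt k i) x) * (w (tt k i) x) ^ p ∂μ)
        - (1/((p+1:ℕ):ℝ)) * ∫ x, ((w T x) ^ (p+1) - (w 0 x) ^ (p+1)) ∂μ|
      ≤ D * T * δ ^ (2*α-1) := by
    intro k δ hδ
    have tel := Finset.sum_range_sub (fun i => ∫ x, w (tt k i) x ^ (p+1) ∂μ) (n k)
    have telt := Finset.sum_range_sub (fun i => tt k i) (n k)
    simp only [hpart0, hpartT] at tel telt
    rw [integral_sub (hintp T ⟨hT.le, le_rfl⟩ _) (hintp 0 ⟨le_rfl, hT.le⟩ _), ← tel]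
    have hp : (0:ℝ) < p + 1 := by positivity
    have e : ∀ a b : ℝ, a - (1/((p+1:ℕ):ℝ)) * b = -(1/((p:ℝ)+1)) * (b - (p+1) * a) := by
      intro a b; push_cast; field_simp; ring
    rw [e, Finset.mul_sum, ← Finset.sum_sub_distrib, abs_mul, abs_neg,
      abs_of_nonneg (by positivity : 0 ≤ 1/((p:ℝ)+1))]
    have h1 : 1/((p:ℝ)+1) ≤ 1 := by
      rw [div_le_one hp]; linarith [(Nat.cast_nonneg p : (0:ℝ) ≤ p)]
    refine (mul_le_of_le_one_left (abs_nonneg _) h1).trans ?_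
    refine (Finset.abs_sum_le_sum_abs _ _).trans ?_
    have : D * T * δ ^ (2*α-1)
        = ∑ i ∈ Finset.range (n k), D * (tt k (i+1) - tt k i) * δ ^ (2*α-1) := by
      rw [← Finset.sum_mul, ← Finset.mul_sum, telt, sub_zero]
    rw [this]
    refine Finset.sum_le_sum fun i hi => ?_
    have hi := Finset.mem_range.1 hi
    refine (hstep _ (hmem k i hi.le) _ (hmem k (i+1) hi)).trans ?_
    have hpos : 0 < tt k (i+1) - tt k i := sub_pos.2 (hmono k i hi)
    have hd := hδ i hi
    rw [abs_of_pos hpos]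
    generalize tt k (i+1) - tt k i = d at hpos hd
    have e2 : (d ^ α)^2 = d * d ^ (2*α-1) := by
      rw [← Real.rpow_natCast, ← Real.rpow_mul hpos.le]
      nth_rewrite 2 [← Real.rpow_one d]
      rw [← Real.rpow_add hpos]
      congr 1; push_cast; ring
    calc C * (L * d ^ α)^2 * μ.real Set.univ = D * d * d ^ (2*α-1) := by
          rw [mul_pow, e2, hD]; ring
      _ ≤ D * d * δ ^ (2*α-1) := by gcongr
  rw [Metric.tendsto_atTop]
  intro ε hε
  have hlim : Tendsto (fun δ : ℝ => D * T * δ ^ (2*α-1)) (nhds 0) (nhds 0) := by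
    have := ((Real.continuousAt_rpow_const 0 (2*α-1) (Or.inr hβ.le)).tendsto).const_mul (D*T)
    simpa [Real.zero_rpow hβ.ne'] using this
  obtain ⟨δ, hδε, hδ⟩ := (((hlim.eventually (gt_mem_nhds hε)).filter_mono
    nhdsWithin_le_nhds).and (self_mem_nhdsWithin : Set.Ioi (0:ℝ) ∈ nhdsWithin 0 (Set.Ioi 0))).exists
  obtain ⟨K, hK⟩ := hmesh δ hδ
  refine ⟨K, fun k hk => ?_⟩
  rw [Real.dist_eq]
  exact (htot k δ (hK k hk)).trans_lt hδε
end
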